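/- arXiv:1606.01018 — 13 statements merged into one kernel-verified Lean document; each statement's English description precedes it below -/
import Mathlib

section
/- Let A be a unital associative algebra over a field F of characteristic zero, let ω ∈ F, and let e₁, e₂ ∈ A satisfy the Hecke relations e₁² = ω·e₁ + 1, e₂² = ω·e₂ + 1 and e₁e₂e₁ = e₂e₁e₂. Define the Baxterised elements Ři(x) = (x − 1)·eᵢ + ω·1 for x ∈ F. Then for all x₁, x₂ ∈ F the braided Yang–Baxter equation holds: Ř₁(x₁)·Ř₂(x₁x₂)·Ř₁(x₂) = Ř₂(x₂)·Ř₁(x₁x₂)·Ř₂(x₁). -/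
/-- Baxterisation of the Hecke algebra: if `e₁, e₂` satisfy the Hecke relations
`eᵢ² = ω·eᵢ + 1` and the braid relation `e₁e₂e₁ = e₂e₁e₂`, then the Baxterised
elements `Ři(x) = (x − 1)·eᵢ + ω·1` satisfy the braided Yang–Baxter equation. -/
theorem baxterised_hecke_satisfies_braided_YBE
    {F : Type*} [Field F] [CharZero F] {A : Type*} [Ring A] [Algebra F A]
    (ω : F) (e₁ e₂ : A)
    (h1 : e₁ * e₁ = ω • e₁ + 1)
    (h2 : e₂ * e₂ = ω • e₂ + 1)
    (hbraid : e₁ * e₂ * e₁ = e₂ * e₁ * e₂)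
    (R : Fin 2 → F → A)
    (hR1 : ∀ x : F, R 0 x = (x - 1) • e₁ + ω • (1 : A))
    (hR2 : ∀ x : F, R 1 x = (x - 1) • e₂ + ω • (1 : A)) :
    ∀ x₁ x₂ : F,
      R 0 x₁ * R 1 (x₁ * x₂) * R 0 x₂ = R 1 x₂ * R 0 (x₁ * x₂) * R 1 x₁ := by
  intro x₁ x₂
  have L : ∀ (a b c : F) (u v : A), u * u = ω • u + 1 →
      (a • u + ω • (1 : A)) * (c • v + ω • (1 : A)) * (b • u + ω • (1 : A)) =
        (a * b * c) • (u * v * u) + (ω * a * c) • (u * v) + (ω * c * b) • (v * u)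
        + (ω ^ 2 * (a * b + a + b)) • u + (ω ^ 2 * c) • v + (ω * a * b + ω ^ 3) • (1 : A) := by
    intro a b c u v hu
    simp only [mul_add, add_mul, smul_mul_assoc, mul_smul_comm, one_mul, mul_one, hu]
    module
  rw [hR1, hR1, hR1, hR2, hR2, hR2, L _ _ _ _ _ h1, L _ _ _ _ _ h2, hbraid]
  module
end

section
/- Let A be a unital associative algebra over a field F, let q ∈ F, and let m ∈ A satisfy m² = −(1 + q)·m. Then for every x ∈ F with x ≠ 0, q·x ≠ 1 and q ≠ x, one has (1 + ((x − 1)/(q·x − 1))·m) · (1 + ((1 − x)/(q − x))·m) = 1. In particular the braided R-matrix Ř(x) = 1 + ((x − 1)/(q·x − 1))·m of the multi-species ASEP is exactly unitary: Ř(x)·Ř(1/x) = 1. -/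
/-- Exact unitarity of the braided R-matrix of the multi-species ASEP: if
`m² = −(1+q)·m` then `(1 + ((x−1)/(qx−1))·m)·(1 + ((1−x)/(q−x))·m) = 1`. -/
theorem multispecies_ASEP_R_unitarity
    {F : Type*} [Field F] {A : Type*} [Ring A] [Algebra F A]
    (q : F) (m : A) (hm : m * m = -((1 + q) • m)) :
    ∀ x : F, x ≠ 0 → q * x ≠ 1 → q ≠ x →
      ((1 : A) + ((x - 1) / (q * x - 1)) • m) *
        ((1 : A) + ((1 - x) / (q - x)) • m) = 1 := by
  intro x _ h1 h2
  have h1' : q * x - 1 ≠ 0 := sub_ne_zero.mpr h1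
  have h2' : q - x ≠ 0 := sub_ne_zero.mpr h2
  have key : (x - 1) / (q * x - 1) + (1 - x) / (q - x)
      - (x - 1) / (q * x - 1) * ((1 - x) / (q - x)) * (1 + q) = 0 := by
    rw [div_mul_div_comm, div_add_div _ _ h1' h2', div_mul_eq_mul_div, ← sub_div,
      div_eq_zero_iff]
    left
    ring
  generalize (x - 1) / (q * x - 1) = a at key ⊢
  generalize (1 - x) / (q - x) = b at key ⊢
  have e : ((1 : A) + a • m) * (1 + b • m) = 1 + (a + b - a * b * (1 + q)) • m := by
    rw [add_mul, mul_add, mul_add, smul_mul_smul_comm, hm]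
    simp only [one_mul, mul_one]
    module
  rw [e, key, zero_smul, add_zero]
end

section
/- Let A be a unital associative algebra over a field F of characteristic zero, ω ∈ F, and e₀, e₁ ∈ A with e₁² = ω·e₁ + 1. Assume e₀ satisfies the relation e₁e₀e₁e₀ − e₀e₁e₀e₁ = ω·(e₀²e₁e₀ − e₀e₁e₀²). Set Ř(x) = (x − 1)·e₁ + ω·1, and for nonzero x ∈ F such that 1 − (1/x − 1)·e₀ is invertible set K̂(x) = (1 − (x − 1)·e₀)·(1 − (1/x − 1)·e₀)⁻¹. Then for all nonzero x₁, x₂ ∈ F such that 1 − (1/x₁ − 1)·e₀ and 1 − (1/x₂ − 1)·e₀ are invertible, the braided reflection equation holds: Ř(x₁/x₂)·K̂(x₁)·Ř(x₁x₂)·K̂(x₂) = K̂(x₂)·Ř(x₁x₂)·K̂(x₁)·Ř(x₁/x₂). -/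
theorem brx_generic {F : Type*} [Field F] {A : Type*} [Ring A] [Algebra F A]
    (ω b : F) (e D U : A) (hb : b ≠ 0)
    (he : e * e = ω • e + 1) (h1 : D * U = 1) (h2 : U * D = 1)
    (hr : b • (e * (1 - D) * e * (1 - D) - (1 - D) * e * (1 - D) * e)
      - ω • ((1 - D) * (1 - D) * e * (1 - D) - (1 - D) * e * ((1 - D) * (1 - D))) = 0)
    (hΔ : ω ^ 2 * (1 + b) - b ^ 2 ≠ 0) :
    (1 - D) * e * U * (b • (e - ω • (1 : A)) - ω • (1 - D))
      - (b • (e - ω • (1 : A)) - ω • (1 - D)) * U * e * (1 - D) = 0 := by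
  have he' : ∀ x : A, e * (e * x) = ω • (e * x) + x := fun x => by
    rw [← mul_assoc, he, add_mul, smul_mul_assoc, one_mul]
  have h1' : ∀ x : A, D * (U * x) = x := fun x => by rw [← mul_assoc, h1, one_mul]
  have h2' : ∀ x : A, U * (D * x) = x := fun x => by rw [← mul_assoc, h2, one_mul]
  have key : (ω ^ 2 * (1 + b) - b ^ 2) •
      ((1 - D) * e * U * (b • (e - ω • (1 : A)) - ω • (1 - D))
      - (b • (e - ω • (1 : A)) - ω • (1 - D)) * U * e * (1 - D)) =
      -((b • e - (ω * (1 + b)) • (1 : A)) * (U * (b • (e * (1 - D) * e * (1 - D) - (1 - D) * e * (1 - D) * e)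
      - ω • ((1 - D) * (1 - D) * e * (1 - D) - (1 - D) * e * ((1 - D) * (1 - D)))) * U) *
        (b • e - (ω * (1 + b)) • (1 : A))) := by
    simp only [mul_sub, sub_mul, mul_add, add_mul, mul_assoc, smul_mul_assoc, mul_smul_comm,
      one_mul, mul_one, smul_sub, smul_add, he, he', h1, h1', h2, h2']
    match_scalars <;> ring
  rw [hr] at key
  simp only [mul_zero, zero_mul, neg_zero] at key
  exact (smul_eq_zero.mp key).resolve_left hΔ

theorem brx_exc {F : Type*} [Field F] {A : Type*} [Ring A] [Algebra F A]
    (ω b μ : F) (e D U : A) (hμ : μ ≠ 0) (hω : ω = μ - μ⁻¹) (hb : b = - ω / μ)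
    (he : e * e = ω • e + 1) (h1 : D * U = 1) (h2 : U * D = 1)
    (hr : b • (e * (1 - D) * e * (1 - D) - (1 - D) * e * (1 - D) * e)
      - ω • ((1 - D) * (1 - D) * e * (1 - D) - (1 - D) * e * ((1 - D) * (1 - D))) = 0)
    (hΔ : μ ^ 2 * (1 + μ ^ 2) ≠ 0) :
    (1 - D) * e * U * (b • (e - ω • (1 : A)) - ω • (1 - D))
      - (b • (e - ω • (1 : A)) - ω • (1 - D)) * U * e * (1 - D) = 0 := by
  have he' : ∀ x : A, e * (e * x) = ω • (e * x) + x := fun x => by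
    rw [← mul_assoc, he, add_mul, smul_mul_assoc, one_mul]
  have h1' : ∀ x : A, D * (U * x) = x := fun x => by rw [← mul_assoc, h1, one_mul]
  have h2' : ∀ x : A, U * (D * x) = x := fun x => by rw [← mul_assoc, h2, one_mul]
  obtain ⟨r, hrr⟩ : ∃ r, r = b • (e * (1 - D) * e * (1 - D) - (1 - D) * e * (1 - D) * e)
      - ω • ((1 - D) * (1 - D) * e * (1 - D) - (1 - D) * e * ((1 - D) * (1 - D))) := ⟨_, rfl⟩
  have key : (μ ^ 2 * (1 + μ ^ 2)) •
      ((1 - D) * e * U * (b • (e - ω • (1 : A)) - ω • (1 - D))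
      - (b • (e - ω • (1 : A)) - ω • (1 - D)) * U * e * (1 - D)) =
      (1 + μ • e) * U * (U * r * U) * (1 + μ • e)
      + μ • ((1 + μ • e) * (U * r * U) * (U * e - e * U))
      + μ ^ 4 • (e * (U * r * U) * e) - μ ^ 2 • (U * r * U) := by
    rw [hrr]
    simp only [mul_sub, sub_mul, mul_add, add_mul, mul_assoc, smul_mul_assoc, mul_smul_comm,
      one_mul, mul_one, smul_sub, smul_add, he, he', h1, h1', h2, h2']
    subst hb
    subst hω
    match_scalars <;> field_simp <;> ring
  rw [hrr, hr] at key
  simp only [mul_zero, zero_mul, smul_zero, add_zero, sub_zero] at key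
  exact (smul_eq_zero.mp key).resolve_left hΔ

theorem brx_final {F : Type*} [Field F] {A : Type*} [Ring A] [Algebra F A]
    (ω x y : F) (e D U e₀ : A) (hx : x ≠ 0) (hy : y ≠ 0) (hx1 : 1 - x ≠ 0)
    (he : e * e = ω • e + 1) (h1 : D * U = 1) (h2 : U * D = 1)
    (he0 : e₀ = (x / (1 - x)) • (1 - D))
    (hE : (x + 1) • ((1 - D) * e * U * ((x⁻¹ - 1) • (e - ω • (1 : A)) - ω • (1 - D))
      - ((x⁻¹ - 1) • (e - ω • (1 : A)) - ω • (1 - D)) * U * e * (1 - D)) = 0) :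
    (1 - (y⁻¹ - 1) • e₀) * ((x / y - 1) • e + ω • (1 : A)) * ((1 - (x - 1) • e₀) * U) *
      ((x * y - 1) • e + ω • (1 : A)) * (1 - (y - 1) • e₀)
    = (1 - (y - 1) • e₀) * ((x * y - 1) • e + ω • (1 : A)) * ((1 - (x - 1) • e₀) * U) *
      ((x / y - 1) • e + ω • (1 : A)) * (1 - (y⁻¹ - 1) • e₀) := by
  have he' : ∀ x : A, e * (e * x) = ω • (e * x) + x := fun x => by
    rw [← mul_assoc, he, add_mul, smul_mul_assoc, one_mul]
  have h1' : ∀ x : A, D * (U * x) = x := fun x => by rw [← mul_assoc, h1, one_mul]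
  have h2' : ∀ x : A, U * (D * x) = x := fun x => by rw [← mul_assoc, h2, one_mul]
  rw [← sub_eq_zero]
  have key : ∀ Z : A, Z = (x + 1) • ((1 - D) * e * U * ((x⁻¹ - 1) • (e - ω • (1 : A)) - ω • (1 - D))
      - ((x⁻¹ - 1) • (e - ω • (1 : A)) - ω • (1 - D)) * U * e * (1 - D)) →
    (1 - (y⁻¹ - 1) • e₀) * ((x / y - 1) • e + ω • (1 : A)) * ((1 - (x - 1) • e₀) * U) *
      ((x * y - 1) • e + ω • (1 : A)) * (1 - (y - 1) • e₀)
    - (1 - (y - 1) • e₀) * ((x * y - 1) • e + ω • (1 : A)) * ((1 - (x - 1) • e₀) * U) *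
      ((x / y - 1) • e + ω • (1 : A)) * (1 - (y⁻¹ - 1) • e₀)
     = ((x / y - 1) * (x * y - 1) * (y - y⁻¹) * (x / (1 - x)) ^ 2) • Z := by
    intro Z hZ
    rw [hZ, he0]
    simp only [mul_sub, sub_mul, mul_add, add_mul, mul_assoc, smul_mul_assoc, mul_smul_comm,
      one_mul, mul_one, smul_sub, smul_add, he, he', h1, h1', h2, h2']
    match_scalars <;> field_simp <;> ring
  rw [key 0 hE.symm, smul_zero]

theorem baxterised_K_satisfies_braided_reflection
    {F : Type*} [Field F] [CharZero F] {A : Type*} [Ring A] [Algebra F A]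
    (ω : F) (e₀ e₁ : A)
    (hHecke : e₁ * e₁ = ω • e₁ + 1)
    (hbdry : e₁ * e₀ * e₁ * e₀ - e₀ * e₁ * e₀ * e₁
        = ω • (e₀ * e₀ * e₁ * e₀ - e₀ * e₁ * (e₀ * e₀)))
    (R : F → A) (hR : ∀ x : F, R x = (x - 1) • e₁ + ω • (1 : A))
    (K : F → A)
    (hK : ∀ x : F, K x = ((1 : A) - (x - 1) • e₀) *
        Ring.inverse ((1 : A) - (x⁻¹ - 1) • e₀)) :
    ∀ x₁ x₂ : F, x₁ ≠ 0 → x₂ ≠ 0 →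
      IsUnit ((1 : A) - (x₁⁻¹ - 1) • e₀) →
      IsUnit ((1 : A) - (x₂⁻¹ - 1) • e₀) →
      R (x₁ / x₂) * K x₁ * R (x₁ * x₂) * K x₂
        = K x₂ * R (x₁ * x₂) * K x₁ * R (x₁ / x₂) := by
  intro x y hx hy hu1 hu2
  have a1 := Ring.mul_inverse_cancel _ hu1
  have a2 := Ring.inverse_mul_cancel _ hu1
  have b1 := Ring.mul_inverse_cancel _ hu2
  have b2 := Ring.inverse_mul_cancel _ hu2
  have main : (1 - (y⁻¹ - 1) • e₀) * R (x / y) * K x * R (x * y) * (1 - (y - 1) • e₀)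
      = (1 - (y - 1) • e₀) * R (x * y) * K x * R (x / y) * (1 - (y⁻¹ - 1) • e₀) := by
    by_cases hx1 : 1 - x = 0
    · have hx1' : x = 1 := (sub_eq_zero.mp hx1).symm
      subst hx1'
      rw [hK, hR, hR]
      simp only [inv_one, sub_self, zero_smul, sub_zero, Ring.inverse_one, mul_one]
      have he' : ∀ x : A, e₁ * (e₁ * x) = ω • (e₁ * x) + x := fun x => by
        rw [← mul_assoc, hHecke, add_mul, smul_mul_assoc, one_mul]
      simp only [mul_sub, sub_mul, mul_add, add_mul, mul_assoc, smul_mul_assoc, mul_smul_comm,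
        one_mul, mul_one, smul_sub, smul_add, hHecke, he']
      match_scalars <;> field_simp <;> ring
    · rw [hK, hR, hR]
      have hb : x⁻¹ - 1 ≠ 0 := by
        intro h
        apply hx1
        field_simp at h
        simpa using h
      have he0 : e₀ = (x / (1 - x)) • (1 - (1 - (x⁻¹ - 1) • e₀)) := by
        rw [sub_sub_cancel, smul_smul]
        have : x / (1 - x) * (x⁻¹ - 1) = 1 := by field_simp
        rw [this, one_smul]
      refine brx_final ω x y e₁ (1 - (x⁻¹ - 1) • e₀) _ e₀ hx hy hx1 hHecke a1 a2 he0 ?_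
      by_cases hm : x + 1 = 0
      · rw [hm, zero_smul]
      have hr : (x⁻¹ - 1) • (e₁ * (1 - (1 - (x⁻¹ - 1) • e₀)) * e₁ * (1 - (1 - (x⁻¹ - 1) • e₀)) - (1 - (1 - (x⁻¹ - 1) • e₀)) * e₁ * (1 - (1 - (x⁻¹ - 1) • e₀)) * e₁)
        - ω • ((1 - (1 - (x⁻¹ - 1) • e₀)) * (1 - (1 - (x⁻¹ - 1) • e₀)) * e₁ * (1 - (1 - (x⁻¹ - 1) • e₀)) - (1 - (1 - (x⁻¹ - 1) • e₀)) * e₁ * ((1 - (1 - (x⁻¹ - 1) • e₀)) * (1 - (1 - (x⁻¹ - 1) • e₀)))) = 0 := by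
        simp only [sub_sub_cancel]
        generalize x⁻¹ - 1 = b
        have : b ^ 3 • (e₁ * e₀ * e₁ * e₀ - e₀ * e₁ * e₀ * e₁
          - ω • (e₀ * e₀ * e₁ * e₀ - e₀ * e₁ * (e₀ * e₀))) = 0 := by
          rw [hbdry, sub_self, smul_zero]
        rw [← this]
        simp only [mul_assoc, smul_mul_assoc, mul_smul_comm]
        module
      by_cases hΔ : ω ^ 2 * (1 + (x⁻¹ - 1)) - (x⁻¹ - 1) ^ 2 = 0
      · have hω : ω ≠ 0 := by
          rintro rfl
          apply hb
          simpa using hΔ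
        have hμ : -ω / (x⁻¹ - 1) ≠ 0 := div_ne_zero (neg_ne_zero.mpr hω) hb
        have hΔ' : ω ^ 2 * x = (1 - x) ^ 2 := by
          field_simp at hΔ
          linear_combination hΔ
        have hμ2 : -ω / (x⁻¹ - 1) = - ω * x / (1 - x) := by
          field_simp
        have hμx : (- ω * x / (1 - x)) ^ 2 = x := by
          field_simp
          linear_combination hΔ'
        rw [brx_exc ω (x⁻¹ - 1) (-ω / (x⁻¹ - 1)) e₁ _ _ hμ ?_ ?_ hHecke a1 a2 hr ?_, smul_zero]
        · rw [hμ2]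
          field_simp
          linear_combination hΔ'
        · field_simp
        · rw [hμ2, hμx]
          exact mul_ne_zero hx (by rwa [add_comm])
      · rw [brx_generic ω (x⁻¹ - 1) e₁ _ _ hb hHecke a1 a2 hr hΔ, smul_zero]
  have hc : (1 - (y⁻¹ - 1) • e₀) * (1 - (y - 1) • e₀)
      = (1 - (y - 1) • e₀) * (1 - (y⁻¹ - 1) • e₀) := by
    simp only [mul_sub, sub_mul, smul_mul_assoc, mul_smul_comm, one_mul, mul_one]
    module
  have k1 : K y * (1 - (y⁻¹ - 1) • e₀) = 1 - (y - 1) • e₀ := by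
    rw [hK, mul_assoc, b2, mul_one]
  have k2 : (1 - (y⁻¹ - 1) • e₀) * K y = 1 - (y - 1) • e₀ := by
    rw [hK, ← mul_assoc, hc, mul_assoc, b1, mul_one]
  apply hu2.mul_left_cancel
  apply hu2.mul_right_cancel
  calc _ = (1 - (y⁻¹ - 1) • e₀) * R (x / y) * K x * R (x * y) * (K y * (1 - (y⁻¹ - 1) • e₀)) := by
        simp only [mul_assoc]
    _ = ((1 - (y⁻¹ - 1) • e₀) * K y) * R (x * y) * K x * R (x / y) * (1 - (y⁻¹ - 1) • e₀) := by
        rw [k1, k2, main]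
    _ = _ := by simp only [mul_assoc]
end

section
/- Let n ≥ 1, ω ∈ ℝ, and let e₀, e₁ be real n×n matrices with e₁² = ω·e₁ + 1. Set Ř(x) = (x − 1)·e₁ + ω·1 and K̂(x) = (1 − (x − 1)·e₀)·(1 − (1/x − 1)·e₀)⁻¹. Suppose there exists ε > 0 such that for all x₁, x₂ ∈ (1 − ε, 1 + ε) \ {0} the matrices 1 − (1/x₁ − 1)·e₀ and 1 − (1/x₂ − 1)·e₀ are invertible and the braided reflection equation Ř(x₁/x₂)·K̂(x₁)·Ř(x₁x₂)·K̂(x₂) = K̂(x₂)·Ř(x₁x₂)·K̂(x₁)·Ř(x₁/x₂) holds. Then e₀ satisfies e₁e₀e₁e₀ − e₀e₁e₀e₁ = ω·(e₀²e₁e₀ − e₀e₁e₀²). -/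
open Filter Topology

theorem aux_K {n : ℕ} (b D : Matrix (Fin n) (Fin n) ℝ) (x : ℝ)
    (hD : D = 1 - (1 / x - 1) • b) (hu : IsUnit D) :
    (1 - (x - 1) • b) * D⁻¹ = 1 + (1 / x - x) • (b * D⁻¹) := by
  have h1 : (1 - (x - 1) • b) = D + (1 / x - x) • b := by
    rw [hD]; module
  have h2 : D * D⁻¹ = 1 := Matrix.mul_nonsing_inv D ((Matrix.isUnit_iff_isUnit_det D).1 hu)
  rw [h1, add_mul, h2, smul_mul_assoc]

theorem aux_B {n : ℕ} (b D E : Matrix (Fin n) (Fin n) ℝ) (q r : ℝ)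
    (hD : D = 1 - q • b) (hE : E = 1 - r • b) (hu : IsUnit D) (hv : IsUnit E) :
    b * D⁻¹ - b * E⁻¹ = (q - r) • ((b * D⁻¹) * (b * E⁻¹)) ∧
    (b * D⁻¹) * (b * E⁻¹) = (b * E⁻¹) * (b * D⁻¹) := by
  have d1 : D * D⁻¹ = 1 := Matrix.mul_nonsing_inv D ((Matrix.isUnit_iff_isUnit_det D).1 hu)
  have d2 : D⁻¹ * D = 1 := Matrix.nonsing_inv_mul D ((Matrix.isUnit_iff_isUnit_det D).1 hu)
  have e1 : E * E⁻¹ = 1 := Matrix.mul_nonsing_inv E ((Matrix.isUnit_iff_isUnit_det E).1 hv)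
  have e2 : E⁻¹ * E = 1 := Matrix.nonsing_inv_mul E ((Matrix.isUnit_iff_isUnit_det E).1 hv)
  have cD : b * D = D * b := by rw [hD]; simp [mul_sub, sub_mul]
  have cDi : b * D⁻¹ = D⁻¹ * b := by
    calc b * D⁻¹ = (D⁻¹ * D) * b * D⁻¹ := by rw [d2, one_mul]
      _ = D⁻¹ * (D * b) * D⁻¹ := by noncomm_ring
      _ = D⁻¹ * b * (D * D⁻¹) := by rw [← cD]; noncomm_ring
      _ = _ := by rw [d1, mul_one]
  have cE : b * E = E * b := by rw [hE]; simp [mul_sub, sub_mul]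
  have cEi : b * E⁻¹ = E⁻¹ * b := by
    calc b * E⁻¹ = (E⁻¹ * E) * b * E⁻¹ := by rw [e2, one_mul]
      _ = E⁻¹ * (E * b) * E⁻¹ := by noncomm_ring
      _ = E⁻¹ * b * (E * E⁻¹) := by rw [← cE]; noncomm_ring
      _ = _ := by rw [e1, mul_one]
  have key : b * D⁻¹ - b * E⁻¹ = (q - r) • ((b * D⁻¹) * (b * E⁻¹)) := by
    have h3 : E - D = (q - r) • b := by rw [hD, hE]; module
    calc b * D⁻¹ - b * E⁻¹ = D⁻¹ * b * (E * E⁻¹) - (D⁻¹ * D) * b * E⁻¹ := by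
          rw [e1, d2, mul_one, one_mul, cDi]
      _ = D⁻¹ * (b * E) * E⁻¹ - D⁻¹ * (D * b) * E⁻¹ := by noncomm_ring
      _ = D⁻¹ * b * (E - D) * E⁻¹ := by rw [← cD]; noncomm_ring
      _ = _ := by rw [h3, cDi]; simp [mul_assoc]
  refine ⟨key, ?_⟩
  have hc : D * E = E * D := by
    rw [hD, hE]; simp only [mul_sub, sub_mul, mul_one, one_mul, smul_mul_assoc, mul_smul_comm]
    module
  have hi : D⁻¹ * E⁻¹ = E⁻¹ * D⁻¹ := by
    rw [← Matrix.mul_inv_rev, ← Matrix.mul_inv_rev, hc]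
  calc (b * D⁻¹) * (b * E⁻¹) = b * (D⁻¹ * b) * E⁻¹ := by noncomm_ring
    _ = b * b * (D⁻¹ * E⁻¹) := by rw [← cDi]; noncomm_ring
    _ = b * (b * E⁻¹) * D⁻¹ := by rw [hi]; noncomm_ring
    _ = _ := by rw [cEi]; rw [show b * (E⁻¹ * b) = E⁻¹ * b * b by rw [← mul_assoc, cEi]]; noncomm_ring

theorem aux_main {n : ℕ} (a B C : Matrix (Fin n) (Fin n) ℝ) (ω x y : ℝ)
    (hx : x ≠ 0) (hy : y ≠ 0) (hx1 : 1 / x - x ≠ 0) (hy1 : 1 / y - y ≠ 0)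
    (hxy : x * y - 1 ≠ 0) (hne : 1 / x - 1 / y ≠ 0)
    (ha : a * a = ω • a + 1) (hBC : B - C = (1 / x - 1 / y) • (B * C)) (hc : B * C = C * B)
    (h : ((x / y - 1) • a + ω • 1) * (1 + (1 / x - x) • B) * ((x * y - 1) • a + ω • 1)
        * (1 + (1 / y - y) • C)
      = (1 + (1 / y - y) • C) * ((x * y - 1) • a + ω • 1) * (1 + (1 / x - x) • B)
        * ((x / y - 1) • a + ω • 1)) :
    x • (a * B * a * C - C * a * B * a) = ω • (B * C * a * C - C * a * (B * C)) := by
  have ha' : ∀ Z, a * (a * Z) = ω • (a * Z) + Z := fun Z => by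
    rw [← mul_assoc, ha, add_mul, smul_mul_assoc, one_mul]
  have hc' : ∀ Z, C * (B * Z) = B * (C * Z) := fun Z => by
    rw [← mul_assoc, ← hc, mul_assoc]
  have h1 : a * B - a * C = (1 / x - 1 / y) • (a * (B * C)) := by
    rw [← mul_sub, hBC, mul_smul_comm]
  have h2 : B * a - C * a = (1 / x - 1 / y) • (B * (C * a)) := by
    rw [← sub_mul, hBC, smul_mul_assoc, mul_assoc]
  have h3 : B * (a * C) - C * (a * C) = (1 / x - 1 / y) • (B * (C * (a * C))) := by
    rw [← sub_mul, hBC, smul_mul_assoc, mul_assoc]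
  have h4 : C * (a * B) - C * (a * C) = (1 / x - 1 / y) • (C * (a * (B * C))) := by
    rw [← mul_sub, ← mul_sub, hBC, mul_smul_comm, mul_smul_comm]
  have h5 : ((1 / x - x) * (1 / y - y) * (x * y - 1)) •
      ((x / y - 1) • (a * (B * (a * C)) - C * (a * (B * a)))
        + ω • (B * (a * C) - C * (a * B))) = 0 := by
    simp only [mul_add, add_mul, mul_one, one_mul, smul_mul_assoc, mul_smul_comm, mul_assoc,
      ha, ha', hc', ← hc, smul_add] at h
    linear_combination (norm := skip) h - (ω * x * (1 / x - x) * (1 / y - y)) • (h1 - h2)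
    match_scalars <;> field_simp <;> ring
  have h6 := (smul_eq_zero.1 h5).resolve_left (mul_ne_zero (mul_ne_zero hx1 hy1) hxy)
  have h7 : (1 / x - 1 / y) • (x • (a * (B * (a * C)) - C * (a * (B * a)))
      - ω • (B * (C * (a * C)) - C * (a * (B * C)))) = 0 := by
    linear_combination (norm := skip) -h6 + ω • (h3 - h4)
    match_scalars <;> field_simp <;> ring
  have h8 := (smul_eq_zero.1 h7).resolve_left hne
  simp only [mul_assoc]
  exact sub_eq_zero.1 h8

theorem aux_lim {n : ℕ} (b : Matrix (Fin n) (Fin n) ℝ) (f : ℝ → ℝ) (hf : ContinuousAt f 0)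
    (h0 : f 0 = 1) :
    ContinuousAt (fun s => b * (1 - (1 / f s - 1) • b)⁻¹) 0 := by
  have hD : ContinuousAt (fun s => (1 : Matrix (Fin n) (Fin n) ℝ) - (1 / f s - 1) • b) 0 := by
    have : ContinuousAt (fun s => 1 / f s - 1) 0 :=
      (continuousAt_const.div hf (by simp [h0])).sub continuousAt_const
    exact continuousAt_const.sub (this.smul continuousAt_const)
  have hd := (Continuous.matrix_det continuous_id).continuousAt.comp hD
  have hadj := (Continuous.matrix_adjugate continuous_id).continuousAt.comp hD
  simp only [Matrix.inv_def, Ring.inverse_eq_inv]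
  refine continuousAt_const.mul (ContinuousAt.smul (hd.inv₀ ?_) hadj)
  simp [h0]

/-- Converse direction: if the Baxterised `K̂(x) = (1−(x−1)e₀)(1−(1/x−1)e₀)⁻¹`
satisfies the braided reflection equation for all spectral parameters in a
neighbourhood of `1`, then `e₀` satisfies the boundary relation
`e₁e₀e₁e₀ − e₀e₁e₀e₁ = ω(e₀²e₁e₀ − e₀e₁e₀²)`. -/
theorem braided_reflection_implies_boundary_relation
    (n : ℕ) (hn : 1 ≤ n) (ω : ℝ)
    (e₀ e₁ : Matrix (Fin n) (Fin n) ℝ)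
    (hHecke : e₁ * e₁ = ω • e₁ + 1)
    (R : ℝ → Matrix (Fin n) (Fin n) ℝ)
    (hR : ∀ x : ℝ, R x = (x - 1) • e₁ + ω • (1 : Matrix (Fin n) (Fin n) ℝ))
    (K : ℝ → Matrix (Fin n) (Fin n) ℝ)
    (hK : ∀ x : ℝ, K x = ((1 : Matrix (Fin n) (Fin n) ℝ) - (x - 1) • e₀) *
        ((1 : Matrix (Fin n) (Fin n) ℝ) - (1 / x - 1) • e₀)⁻¹)
    (hrefl : ∃ ε > (0 : ℝ), ∀ x₁ x₂ : ℝ,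
      x₁ ∈ Set.Ioo (1 - ε) (1 + ε) → x₂ ∈ Set.Ioo (1 - ε) (1 + ε) →
      x₁ ≠ 0 → x₂ ≠ 0 →
      IsUnit ((1 : Matrix (Fin n) (Fin n) ℝ) - (1 / x₁ - 1) • e₀) ∧
      IsUnit ((1 : Matrix (Fin n) (Fin n) ℝ) - (1 / x₂ - 1) • e₀) ∧
      R (x₁ / x₂) * K x₁ * R (x₁ * x₂) * K x₂
        = K x₂ * R (x₁ * x₂) * K x₁ * R (x₁ / x₂)) :
    e₁ * e₀ * e₁ * e₀ - e₀ * e₁ * e₀ * e₁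
      = ω • (e₀ * e₀ * e₁ * e₀ - e₀ * e₁ * (e₀ * e₀)) := by
  obtain ⟨ε, hε, H⟩ := hrefl
  have hev : ∀ᶠ s in 𝓝[>] (0 : ℝ), (1 + s) •
      (e₁ * (e₀ * (1 - (1 / (1 + s) - 1) • e₀)⁻¹) * e₁ *
          (e₀ * (1 - (1 / (1 + 2 * s) - 1) • e₀)⁻¹)
        - (e₀ * (1 - (1 / (1 + 2 * s) - 1) • e₀)⁻¹) * e₁ *
          (e₀ * (1 - (1 / (1 + s) - 1) • e₀)⁻¹) * e₁)
      = ω • ((e₀ * (1 - (1 / (1 + s) - 1) • e₀)⁻¹) *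
          (e₀ * (1 - (1 / (1 + 2 * s) - 1) • e₀)⁻¹) * e₁ *
          (e₀ * (1 - (1 / (1 + 2 * s) - 1) • e₀)⁻¹)
        - (e₀ * (1 - (1 / (1 + 2 * s) - 1) • e₀)⁻¹) * e₁ *
          ((e₀ * (1 - (1 / (1 + s) - 1) • e₀)⁻¹) *
          (e₀ * (1 - (1 / (1 + 2 * s) - 1) • e₀)⁻¹))) := by
    have hmem : Set.Ioo (0 : ℝ) (ε / 2) ∈ 𝓝[>] (0 : ℝ) := Ioo_mem_nhdsGT (by linarith)
    filter_upwards [hmem] with s hs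
    obtain ⟨hs0, hs1⟩ := hs
    have hx : (1 + s) ≠ 0 := by positivity
    have hy : (1 + 2 * s) ≠ 0 := by positivity
    have hcn : ∀ z : ℝ, 1 < z → 1 / z - z ≠ 0 := fun z hz => by
      have : 1 / z < 1 := by rw [div_lt_one (by linarith)]; exact hz
      linarith
    obtain ⟨hu, hv, hE⟩ := H (1 + s) (1 + 2 * s) ⟨by linarith, by linarith⟩
      ⟨by linarith, by linarith⟩ hx hy
    rw [hR, hR, hK, hK, aux_K e₀ _ _ rfl hu, aux_K e₀ _ _ rfl hv] at hE
    obtain ⟨hB, hc⟩ := aux_B e₀ _ _ _ _ rfl rfl hu hv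
    refine aux_main e₁ _ _ ω _ _ hx hy (hcn _ (by linarith)) (hcn _ (by linarith)) ?_ ?_
      hHecke ?_ hc hE
    · nlinarith
    · have : 1 / (1 + 2 * s) < 1 / (1 + s) :=
        one_div_lt_one_div_of_lt (by linarith) (by linarith)
      linarith
    · rw [hB]; congr 1; ring
  have c1 := aux_lim e₀ (fun s => 1 + s) (by fun_prop) (by simp)
  have c2 := aux_lim e₀ (fun s => 1 + 2 * s) (by fun_prop) (by simp)
  have k : ∀ M : Matrix (Fin n) (Fin n) ℝ, ContinuousAt (fun _ : ℝ => M) 0 :=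
    fun M => continuousAt_const
  have cs : ContinuousAt (fun s : ℝ => 1 + s) 0 := by fun_prop
  have L := cs.smul (((((k e₁).mul c1).mul (k e₁)).mul c2).sub
    (((c2.mul (k e₁)).mul c1).mul (k e₁)))
  have Rr := (continuousAt_const (y := ω) (x := (0 : ℝ))).smul
    ((((c1.mul c2).mul (k e₁)).mul c2).sub ((c2.mul (k e₁)).mul (c1.mul c2)))
  have hfin := tendsto_nhds_unique_of_eventuallyEq
    (L.tendsto.mono_left nhdsWithin_le_nhds) (Rr.tendsto.mono_left nhdsWithin_le_nhds) hev
  simpa using hfin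
end

section
/- Let A be a unital associative algebra over a field F of characteristic zero, ω ∈ F, and e₀, e₁ ∈ A satisfying e₁e₀e₁e₀ − e₀e₁e₀e₁ = ω·(e₀²e₁e₀ − e₀e₁e₀²). Then for every natural number k: e₁e₀e₁e₀^k − e₀^k e₁e₀e₁ = ω·(e₀^{k+1}e₁e₀ − e₀e₁e₀^{k+1}). -/
/-- Lemma (4.19) of the paper: the boundary relation
`e₁e₀e₁e₀ − e₀e₁e₀e₁ = ω(e₀²e₁e₀ − e₀e₁e₀²)` implies, for every `k`,
`e₁e₀e₁e₀^k − e₀^k e₁e₀e₁ = ω(e₀^{k+1}e₁e₀ − e₀e₁e₀^{k+1})`. -/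
theorem boundary_relation_power_lemma_one
    {F : Type*} [Field F] [CharZero F] {A : Type*} [Ring A] [Algebra F A]
    (ω : F) (e₀ e₁ : A)
    (hbdry : e₁ * e₀ * e₁ * e₀ - e₀ * e₁ * e₀ * e₁
        = ω • (e₀ ^ 2 * e₁ * e₀ - e₀ * e₁ * e₀ ^ 2)) :
    ∀ k : ℕ, e₁ * e₀ * e₁ * e₀ ^ k - e₀ ^ k * e₁ * e₀ * e₁
        = ω • (e₀ ^ (k + 1) * e₁ * e₀ - e₀ * e₁ * e₀ ^ (k + 1)) := by
  intro k
  induction k with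
  | zero => simp
  | succ k ih =>
    have h : e₁ * e₀ * e₁ * e₀ ^ (k + 1) - e₀ ^ (k + 1) * e₁ * e₀ * e₁
        = (e₁ * e₀ * e₁ * e₀ ^ k - e₀ ^ k * e₁ * e₀ * e₁) * e₀
          + e₀ ^ k * (e₁ * e₀ * e₁ * e₀ - e₀ * e₁ * e₀ * e₁) := by
      rw [pow_succ]
      noncomm_ring
    rw [h, ih, hbdry, smul_mul_assoc, mul_smul_comm, ← smul_add]
    congr 1
    have h1 : e₀ ^ (k + 1 + 1) = e₀ ^ k * e₀ ^ 2 := by rw [← pow_add]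
    have h2 : e₀ ^ (k + 1 + 1) = e₀ ^ (k + 1) * e₀ := pow_succ _ _
    have h3 : e₀ ^ (k + 1) = e₀ ^ k * e₀ := pow_succ _ _
    simp only [sub_mul, mul_sub, h2, h3, pow_two, mul_assoc]
    abel
end

section
/- Let A be a unital associative algebra over a field F of characteristic zero, ω ∈ F, and e₀, e₁ ∈ A with e₁² = ω·e₁ + 1 and e₁e₀e₁e₀ − e₀e₁e₀e₁ = ω·(e₀²e₁e₀ − e₀e₁e₀²). Then for every natural number k: e₁e₀^k e₁e₀ − e₀e₁e₀^k e₁ = ω·(e₀^{k+1}e₁e₀ − e₀e₁e₀^{k+1} + e₀^k e₁e₀ − e₀e₁e₀^k). -/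
theorem boundary_step_aux {F : Type*} [Field F] {A : Type*} [Ring A] [Algebra F A]
    (ω : F) (a b p h G K : A) (hp : a * p = p * a)
    (hh : h = b * b - ω • b - 1)
    (hG : G = b * a * b * a - a * b * a * b - ω • (a * a * b * a - a * b * a * a))
    (hK : K = b * p * b * a - a * b * p * b
      - ω • (p * a * b * a - a * b * p * a + p * b * a - a * b * p)) :
    b * (p * a) * b * a - a * b * (p * a) * b
      - ω • (p * a * a * b * a - a * b * (p * a) * a + p * a * b * a - a * b * (p * a))
    = -(b * p * h * a * b * a - a * b * p * h * a * b) + b * p * b * G + K * (b * a * b)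
      - ω • (K * a * b) + ω • (K * (a * b * a - b * a - b * a * a + a * b))
      + ω • (a * b * p * G) - ω • (a * b * p * h * (a + a * a))
      - ω • ((p + p * a) * b * G) + ω • ((p + p * a) * h * a * b * a) := by
  have hp' : ∀ x, a * (p * x) = p * (a * x) := fun x => by
    rw [← mul_assoc, hp, mul_assoc]
  subst hh hG hK
  simp only [mul_add, add_mul, mul_sub, sub_mul, smul_mul_assoc, mul_smul_comm, mul_assoc,
    mul_one, one_mul, hp, hp', neg_mul, mul_neg]
  module

/-- Lemma (4.20) of the paper: under the Hecke relation for `e₁` and the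
boundary relation for `e₀`, for every `k`,
`e₁e₀^k e₁e₀ − e₀e₁e₀^k e₁ = ω(e₀^{k+1}e₁e₀ − e₀e₁e₀^{k+1} + e₀^k e₁e₀ − e₀e₁e₀^k)`. -/
theorem boundary_relation_power_lemma_two
    {F : Type*} [Field F] [CharZero F] {A : Type*} [Ring A] [Algebra F A]
    (ω : F) (e₀ e₁ : A)
    (hHecke : e₁ * e₁ = ω • e₁ + 1)
    (hbdry : e₁ * e₀ * e₁ * e₀ - e₀ * e₁ * e₀ * e₁
        = ω • (e₀ ^ 2 * e₁ * e₀ - e₀ * e₁ * e₀ ^ 2)) :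
    ∀ k : ℕ, e₁ * e₀ ^ k * e₁ * e₀ - e₀ * e₁ * e₀ ^ k * e₁
        = ω • (e₀ ^ (k + 1) * e₁ * e₀ - e₀ * e₁ * e₀ ^ (k + 1)
            + e₀ ^ k * e₁ * e₀ - e₀ * e₁ * e₀ ^ k) := by
  intro k
  induction k with
  | zero =>
    simp only [pow_zero, mul_one, one_mul, zero_add, pow_one]
    rw [mul_assoc e₀ e₁ e₁, hHecke]
    simp only [mul_add, add_mul, smul_mul_assoc, mul_smul_comm, mul_one, one_mul]
    module
  | succ k ih =>
    have key := boundary_step_aux ω e₀ e₁ (e₀ ^ k) 0 0 0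
      (by rw [← pow_succ, ← pow_succ'])
      (by rw [hHecke]; abel)
      (by rw [hbdry]; simp only [pow_two, mul_assoc, sub_self])
      (by rw [ih]; simp only [pow_succ, mul_assoc, sub_self])
    simp only [mul_zero, zero_mul, smul_zero, sub_self, neg_zero, add_zero] at key
    rw [sub_eq_zero] at key
    simp only [pow_succ, mul_assoc] at key ⊢
    exact key
end

section
/- Let A be a unital associative algebra over a field F of characteristic zero, ω ∈ F, and e₀, e₁ ∈ A with e₁² = ω·e₁ + 1 and e₁e₀e₁e₀ − e₀e₁e₀e₁ = ω·(e₀²e₁e₀ − e₀e₁e₀²). Then for every natural number k: e₁(e₀ + 1)^k e₁e₀ − e₀e₁(e₀ + 1)^k e₁ = ω·((e₀ + 1)^{k+1} e₁e₀ − e₀e₁(e₀ + 1)^{k+1}). -/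
theorem brp_step {F : Type*} [Field F] {A : Type*} [Ring A] [Algebra F A]
    (ω : F) (hω : ω ≠ 0) (x a p : A)
    (haa : a * a = ω • a + 1)
    (hp : p * x = x * p)
    (h1 : (a * x * a) * p - p * (a * x * a) = ω • (x * p * a * x - x * a * x * p))
    (h1' : (a * x * a) * x - x * (a * x * a) = ω • (x * x * a * x - x * a * x * x))
    (hS : a * p * a * x - x * a * p * a
      = ω • ((x + 1) * p * a * x - x * a * (x + 1) * p))
    (hC : (p * a * x - x * a * p) + a * (p * a * x - x * a * p) * a = 0) :
    (a * ((x + 1) * p) * a * x - x * a * ((x + 1) * p) * a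
      = ω • ((x + 1) * ((x + 1) * p) * a * x - x * a * (x + 1) * ((x + 1) * p))) ∧
    ((((x + 1) * p) * a * x - x * a * ((x + 1) * p))
      + a * (((x + 1) * p) * a * x - x * a * ((x + 1) * p)) * a = 0) := by
  have haa' : ∀ t, a * (a * t) = ω • (a * t) + t := fun t => by
    rw [← mul_assoc, haa, add_mul, smul_mul_assoc, one_mul]
  have hp' : ∀ t, p * (x * t) = x * (p * t) := fun t => by
    rw [← mul_assoc, hp, mul_assoc]
  have hSl := congrArg (fun t => a * t) hS
  have hSr := congrArg (fun t => t * a) hS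
  have hSlr := congrArg (fun t => a * t * a) hS
  have h1x := congrArg (fun t => x * t) h1
  have h1p := congrArg (fun t => t * p) h1'
  simp only [mul_add, add_mul, mul_sub, sub_mul, smul_mul_assoc, mul_smul_comm, mul_assoc,
    smul_add, smul_sub, one_mul, mul_one, haa, haa', hp, hp'] at *
  constructor
  · apply smul_right_injective A hω
    simp only [smul_add, smul_sub]
    linear_combination (norm := module) hC - hSl - hSr + ω • h1 + ω • h1x + ω • h1p + ω • hS
  · apply smul_right_injective A hω
    simp only [smul_add, smul_sub, smul_zero]
    linear_combination (norm := module) ω • hC - hSlr - h1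

/-- Lemma (4.21) of the paper: under the Hecke relation for `e₁` and the
boundary relation for `e₀`, for every `k`,
`e₁(e₀+1)^k e₁e₀ − e₀e₁(e₀+1)^k e₁ = ω((e₀+1)^{k+1}e₁e₀ − e₀e₁(e₀+1)^{k+1})`. -/
theorem boundary_relation_power_lemma_three
    {F : Type*} [Field F] [CharZero F] {A : Type*} [Ring A] [Algebra F A]
    (ω : F) (e₀ e₁ : A)
    (hHecke : e₁ * e₁ = ω • e₁ + 1)
    (hbdry : e₁ * e₀ * e₁ * e₀ - e₀ * e₁ * e₀ * e₁
        = ω • (e₀ ^ 2 * e₁ * e₀ - e₀ * e₁ * e₀ ^ 2)) :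
    ∀ k : ℕ, e₁ * (e₀ + 1) ^ k * e₁ * e₀ - e₀ * e₁ * (e₀ + 1) ^ k * e₁
        = ω • ((e₀ + 1) ^ (k + 1) * e₁ * e₀ - e₀ * e₁ * (e₀ + 1) ^ (k + 1)) := by
  have h1' : (e₁ * e₀ * e₁) * e₀ - e₀ * (e₁ * e₀ * e₁)
      = ω • (e₀ * e₀ * e₁ * e₀ - e₀ * e₁ * e₀ * e₀) := by
    simpa only [pow_two, mul_assoc] using hbdry
  by_cases hω : ω = 0
  · subst hω
    have haa : e₁ * e₁ = 1 := by simpa using hHecke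
    have hc : Commute (e₁ * (e₀ + 1) * e₁) e₀ := by
      have h2 : e₁ * (e₀ + 1) * e₁ = e₁ * e₀ * e₁ + 1 := by
        rw [mul_add, add_mul, mul_one, haa]
      rw [h2]
      refine Commute.add_left ?_ (Commute.one_left _)
      rw [zero_smul] at h1'
      exact sub_eq_zero.mp h1'
    have hpow : ∀ k : ℕ, e₁ * (e₀ + 1) ^ k * e₁ = (e₁ * (e₀ + 1) * e₁) ^ k := by
      intro k
      induction k with
      | zero => simp [haa]
      | succ k ih =>
        rw [pow_succ (e₁ * (e₀ + 1) * e₁), ← ih, pow_succ]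
        calc e₁ * ((e₀ + 1) ^ k * (e₀ + 1)) * e₁
            = e₁ * (e₀ + 1) ^ k * 1 * (e₀ + 1) * e₁ := by simp only [mul_assoc, one_mul]
          _ = _ := by rw [← haa]; simp only [mul_assoc]
    intro k
    have h3 := (hc.pow_left k).eq
    rw [← hpow] at h3
    rw [zero_smul, h3]
    simp only [mul_assoc, sub_self]
  · have hcx : ∀ k : ℕ, Commute ((e₀ + 1) ^ k) e₀ := fun k =>
      ((Commute.refl e₀).add_left (Commute.one_left _)).pow_left k
    have hz : Commute (e₁ * e₀ * e₁ + ω • (e₀ * e₁ * e₀)) (e₀ + 1) := by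
      refine Commute.add_right ?_ (Commute.one_right _)
      change _ * _ = _ * _
      simp only [mul_add, add_mul, smul_mul_assoc, mul_smul_comm, mul_assoc, smul_sub] at h1' ⊢
      linear_combination (norm := module) h1'
    have h1 : ∀ k : ℕ, (e₁ * e₀ * e₁) * (e₀ + 1) ^ k - (e₀ + 1) ^ k * (e₁ * e₀ * e₁)
        = ω • (e₀ * (e₀ + 1) ^ k * e₁ * e₀ - e₀ * e₁ * e₀ * (e₀ + 1) ^ k) := by
      intro k
      have h2 := (hz.pow_right k).eq
      rw [← (hcx k).eq]
      simp only [mul_add, add_mul, smul_mul_assoc, mul_smul_comm, mul_assoc, smul_sub] at h2 ⊢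
      linear_combination (norm := module) h2
    have haa' : ∀ t, e₁ * (e₁ * t) = ω • (e₁ * t) + t := fun t => by
      rw [← mul_assoc, hHecke, add_mul, smul_mul_assoc, one_mul]
    have main : ∀ k : ℕ, (e₁ * (e₀ + 1) ^ k * e₁ * e₀ - e₀ * e₁ * (e₀ + 1) ^ k * e₁
        = ω • ((e₀ + 1) * (e₀ + 1) ^ k * e₁ * e₀ - e₀ * e₁ * (e₀ + 1) * (e₀ + 1) ^ k)) ∧
        (((e₀ + 1) ^ k * e₁ * e₀ - e₀ * e₁ * (e₀ + 1) ^ k)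
          + e₁ * ((e₀ + 1) ^ k * e₁ * e₀ - e₀ * e₁ * (e₀ + 1) ^ k) * e₁ = 0) := by
      intro k
      induction k with
      | zero =>
        simp only [pow_zero, mul_add, add_mul, mul_sub, sub_mul, smul_mul_assoc, mul_smul_comm,
          mul_assoc, smul_add, smul_sub, one_mul, mul_one, hHecke, haa']
        constructor
        · module
        · module
      | succ k ih =>
        rw [pow_succ']
        exact brp_step ω hω e₀ e₁ _ hHecke (hcx k).eq (h1 k) h1' ih.1 ih.2
    intro k
    rw [(main k).1, pow_succ']
    simp only [mul_assoc]
end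

section
/- Let A be a unital associative algebra over a field F of characteristic zero, ω ∈ F, and e₀, e₁ ∈ A with e₁² = ω·e₁ + 1 and e₁e₀e₁e₀ − e₀e₁e₀e₁ = ω·(e₀²e₁e₀ − e₀e₁e₀²). Then for every natural number k: e₁·e₀·(e₀ + 1)^k·e₁·e₀ − e₀·e₁·e₀·(e₀ + 1)^k·e₁ = ω·(e₀·(e₀ + 1)^{k+1}·e₁·e₀ − e₀·e₁·e₀·(e₀ + 1)^{k+1}). -/
section helpers
variable {F : Type*} [Field F] {A : Type*} [Ring A] [Algebra F A]

lemma bd_comm (ω : F) (x s : A)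
    (hb : s * x * s * x - x * s * x * s = ω • (x ^ 2 * s * x - x * s * x ^ 2)) (n : ℕ) :
    s * x * s * x ^ n - x ^ n * s * x * s
      = ω • (x ^ (n + 1) * s * x - x * s * x ^ (n + 1)) := by
  induction n with
  | zero => simp
  | succ n ih =>
    have e : s * x * s * x ^ (n + 1) - x ^ (n + 1) * s * x * s
        = (s * x * s * x ^ n - x ^ n * s * x * s) * x
          + x ^ n * (s * x * s * x - x * s * x * s) := by
      simp only [pow_succ]; noncomm_ring
    rw [e, ih, hb, smul_mul_assoc, mul_smul_comm, ← smul_add]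
    congr 1
    simp only [pow_succ, pow_zero, one_mul, mul_sub, sub_mul, mul_assoc]
    abel

lemma bd_zero (x s : A) (hs : s * s = 1) (hb : s * x * s * x = x * s * x * s) (n : ℕ) :
    s * x ^ n * s * x = x * s * x ^ n * s := by
  induction n with
  | zero => simp [hs, mul_assoc]
  | succ n ih =>
    have e : s * x ^ (n + 1) * s = (s * x ^ n * s) * (s * x * s) := by
      calc s * x ^ (n + 1) * s = s * x ^ n * 1 * x * s := by simp [pow_succ, mul_assoc]
        _ = _ := by rw [← hs]; simp only [mul_assoc]
    calc s * x ^ (n + 1) * s * x = (s * x ^ n * s) * (s * x * s * x) := by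
          rw [e]; simp only [mul_assoc]
      _ = (s * x ^ n * s * x) * (s * x * s) := by rw [hb]; simp only [mul_assoc]
      _ = x * (s * x ^ (n + 1) * s) := by rw [ih, e]; simp only [mul_assoc]
      _ = _ := by simp only [mul_assoc]

/-- If `s` conjugation flips `Q`, it anticommutes up to `ω`. -/
lemma bd_anti (ω : F) (s Q : A) (hs : s * s = ω • s + 1)
    (h : (s - ω • 1) * Q * (s - ω • 1) = -Q) : Q * s + s * Q = ω • Q := by
  have h1 : s * (s - ω • (1 : A)) = 1 := by
    rw [mul_sub, hs]; simp
  have h2 : Q * (s - ω • (1 : A)) = - (s * Q) := by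
    calc Q * (s - ω • (1 : A)) = (s * (s - ω • (1 : A))) * Q * (s - ω • (1 : A)) := by
          rw [h1, one_mul]
      _ = s * ((s - ω • (1 : A)) * Q * (s - ω • (1 : A))) := by simp only [mul_assoc]
      _ = _ := by rw [h, mul_neg]
  rw [mul_sub, mul_smul_comm, mul_one] at h2
  have h3 : Q * s = ω • Q - s * Q := by
    rw [sub_eq_iff_eq_add] at h2; rw [h2]; abel
  rw [h3]; abel

lemma bd_flip (ω : F) (x s X Y : A) (hs : s * s = ω • s + 1)
    (hY : s * x * s * X - X * s * x * s = ω • (Y * s * x - x * s * Y))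
    (h : s * X * s * x - x * s * X * s
      = ω • ((Y * s * x - x * s * Y) + (X * s * x - x * s * X))) (hω : ω ≠ 0) :
    ((Y * s * x - x * s * Y) + (X * s * x - x * s * X)) * s
      + s * ((Y * s * x - x * s * Y) + (X * s * x - x * s * X))
      = ω • ((Y * s * x - x * s * Y) + (X * s * x - x * s * X)) := by
  apply bd_anti ω s _ hs
  have h1 : s * (s - ω • (1 : A)) = 1 := by
    rw [mul_sub, hs]; simp
  have h1' : (s - ω • (1 : A)) * s = 1 := by
    rw [sub_mul, hs]; simp
  apply smul_right_injective A hω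
  change ω • _ = ω • _
  rw [← smul_mul_assoc, ← mul_smul_comm, ← h, smul_neg, smul_add, ← hY]
  have e : (s - ω • (1 : A)) * (s * X * s * x - x * s * X * s) * (s - ω • (1 : A))
      = ((s - ω • (1 : A)) * s) * X * s * x * (s - ω • (1 : A))
        - (s - ω • (1 : A)) * x * s * X * (s * (s - ω • (1 : A))) := by
    simp only [mul_sub, sub_mul, mul_assoc]
    abel
  rw [e, h1, h1']
  simp only [mul_sub, sub_mul, mul_assoc, one_mul, mul_one, smul_mul_assoc, mul_smul_comm, smul_sub]
  abel

lemma bd_pow (ω : F) (x s : A) (hs : s * s = ω • s + 1)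
    (hb : s * x * s * x - x * s * x * s = ω • (x ^ 2 * s * x - x * s * x ^ 2))
    (hω : ω ≠ 0) (n : ℕ) :
    (x ^ (n + 1) * s * x - x * s * x ^ (n + 1)) * s
      + s * (x ^ (n + 1) * s * x - x * s * x ^ (n + 1))
      = ω • (x ^ (n + 1) * s * x - x * s * x ^ (n + 1)) ∧
    s * x ^ (n + 1) * s * x - x * s * x ^ (n + 1) * s
      = ω • ((x ^ (n + 2) * s * x - x * s * x ^ (n + 2))
        + (x ^ (n + 1) * s * x - x * s * x ^ (n + 1))) := by
  have key : ∀ n : ℕ, (x ^ (n + 1) * s * x - x * s * x ^ (n + 1)) * s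
      + s * (x ^ (n + 1) * s * x - x * s * x ^ (n + 1))
      = ω • (x ^ (n + 1) * s * x - x * s * x ^ (n + 1)) →
      s * x ^ (n + 1) * s * x - x * s * x ^ (n + 1) * s
      = ω • ((x ^ (n + 2) * s * x - x * s * x ^ (n + 2))
        + (x ^ (n + 1) * s * x - x * s * x ^ (n + 1))) := by
    intro n h
    rw [smul_add, ← h, ← bd_comm ω x s hb (n + 1)]
    simp only [mul_sub, sub_mul, mul_assoc]
    abel
  induction n with
  | zero =>
    have h0 : (x ^ (0 + 1) * s * x - x * s * x ^ (0 + 1)) = 0 := by simp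
    have h1 : (x ^ (0 + 1) * s * x - x * s * x ^ (0 + 1)) * s
      + s * (x ^ (0 + 1) * s * x - x * s * x ^ (0 + 1))
      = ω • (x ^ (0 + 1) * s * x - x * s * x ^ (0 + 1)) := by rw [h0]; simp
    exact ⟨h1, key 0 h1⟩
  | succ n ih =>
    obtain ⟨i1, i2⟩ := ih
    have f := bd_flip ω x s _ _ hs (bd_comm ω x s hb (n + 1)) i2 hω
    have h1 : (x ^ (n + 1 + 1) * s * x - x * s * x ^ (n + 1 + 1)) * s
      + s * (x ^ (n + 1 + 1) * s * x - x * s * x ^ (n + 1 + 1))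
      = ω • (x ^ (n + 1 + 1) * s * x - x * s * x ^ (n + 1 + 1)) := by
      rw [smul_add, ← i1, add_mul, mul_add, add_add_add_comm] at f
      exact add_right_cancel f
    exact ⟨h1, key (n + 1) h1⟩

lemma bd_main (ω : F) (x s : A) (hs : s * s = ω • s + 1)
    (hb : s * x * s * x - x * s * x * s = ω • (x ^ 2 * s * x - x * s * x ^ 2)) (n : ℕ) :
    s * x ^ (n + 1) * s * x - x * s * x ^ (n + 1) * s
      = ω • ((x ^ (n + 2) * s * x - x * s * x ^ (n + 2))
        + (x ^ (n + 1) * s * x - x * s * x ^ (n + 1))) := by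
  by_cases hω : ω = 0
  · subst hω
    rw [zero_smul] at *
    rw [zero_add] at hs
    rw [sub_eq_zero] at *
    exact bd_zero x s hs hb _
  · exact (bd_pow ω x s hs hb hω n).2

lemma bd_all (ω : F) (x s : A) (hs : s * s = ω • s + 1)
    (hb : s * x * s * x - x * s * x * s = ω • (x ^ 2 * s * x - x * s * x ^ 2)) (k : ℕ) :
    ∀ m : ℕ, s * (x ^ (m + 1) * (x + 1) ^ k) * s * x - x * s * (x ^ (m + 1) * (x + 1) ^ k) * s
      = ω • (x ^ (m + 1) * (x + 1) ^ (k + 1) * s * x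
        - x * s * (x ^ (m + 1) * (x + 1) ^ (k + 1))) := by
  have e : ∀ m k : ℕ, x ^ (m + 1) * (x + 1) ^ (k + 1)
      = x ^ (m + 1 + 1) * (x + 1) ^ k + x ^ (m + 1) * (x + 1) ^ k := by
    intro m k
    rw [pow_succ' (x + 1) k, pow_succ x (m + 1)]
    simp only [mul_assoc, add_mul, mul_add, one_mul]
  induction k with
  | zero =>
    intro m
    rw [e m 0]
    simp only [pow_zero, mul_one]
    rw [bd_main ω x s hs hb m]
    congr 1
    simp only [mul_add, add_mul]
    abel
  | succ k ih =>
    intro m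
    have h1 := ih m
    have h2 := ih (m + 1)
    rw [e m (k + 1), e m k]
    have h3 := congrArg₂ (· + ·) h2 h1
    simp only [← smul_add] at h3
    calc _ = _ := by simp only [mul_add, add_mul]; abel
      _ = _ := h3
      _ = _ := by rw [e m k]; congr 1; simp only [mul_add, add_mul]; abel

end helpers

/-- Lemma (4.22) of the paper: under the Hecke relation for `e₁` and the
boundary relation for `e₀`, for every `k`,
`e₁e₀(e₀+1)^k e₁e₀ − e₀e₁e₀(e₀+1)^k e₁ = ω(e₀(e₀+1)^{k+1}e₁e₀ − e₀e₁e₀(e₀+1)^{k+1})`. -/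
theorem boundary_relation_power_lemma_four
    {F : Type*} [Field F] [CharZero F] {A : Type*} [Ring A] [Algebra F A]
    (ω : F) (e₀ e₁ : A)
    (hHecke : e₁ * e₁ = ω • e₁ + 1)
    (hbdry : e₁ * e₀ * e₁ * e₀ - e₀ * e₁ * e₀ * e₁
        = ω • (e₀ ^ 2 * e₁ * e₀ - e₀ * e₁ * e₀ ^ 2)) :
    ∀ k : ℕ, e₁ * e₀ * (e₀ + 1) ^ k * e₁ * e₀ - e₀ * e₁ * e₀ * (e₀ + 1) ^ k * e₁
        = ω • (e₀ * (e₀ + 1) ^ (k + 1) * e₁ * e₀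
            - e₀ * e₁ * e₀ * (e₀ + 1) ^ (k + 1)) := by
  intro k
  have h := bd_all ω e₀ e₁ hHecke hbdry k 0
  simpa only [zero_add, pow_one, mul_assoc] using h
end

section
/- Let A be a unital associative algebra over a field F of characteristic zero, ω ∈ F, and e₀, e₁ ∈ A with e₁² = ω·e₁ + 1 and e₁e₀e₁e₀ − e₀e₁e₀e₁ = ω·(e₀²e₁e₀ − e₀e₁e₀²). Let x ∈ F be nonzero with 1 − (1/x − 1)·e₀ invertible and set K̂(x) = (1 − (x − 1)·e₀)·(1 − (1/x − 1)·e₀)⁻¹. Then e₁·K̂(x)·e₁·e₀ − e₀·e₁·K̂(x)·e₁ = ω·((e₀ + 1)·K̂(x)·e₁·e₀ − e₀·e₁·(e₀ + 1)·K̂(x)). -/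
set_option linter.unusedSimpArgs false

/-- Degenerate case, `s = 0`: here `μ = -l`. -/
theorem aux_nil {F : Type*} [Field F] {A : Type*} [Ring A] [Algebra F A]
    (l : F) (hl : l * l = -1) (P u v : A) (huv : u * v = 1) (hvu : v * u = 1)
    (hP : P * P = 0)
    (H : P * u * P * v - v * P * u * P + l • (v * P - P * v) + l • (u * P - P * u) = 0) :
    u * P * v * P - P * v * P * u + l • (P * v - v * P) + l • (P * u - u * P) = 0 := by
  have huv' : ∀ z, u * (v * z) = z := fun z => by rw [← mul_assoc, huv, one_mul]
  have hvu' : ∀ z, v * (u * z) = z := fun z => by rw [← mul_assoc, hvu, one_mul]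
  have hP' : ∀ z, P * (P * z) = 0 := fun z => by rw [← mul_assoc, hP, zero_mul]
  have hl0 : l ≠ 0 := by rintro rfl; simp at hl
  have H1 := congrArg (fun z => P * z) H
  have H2 := congrArg (fun z => z * P) H
  simp only [mul_add, add_mul, mul_sub, sub_mul, smul_mul_assoc, mul_smul_comm, mul_assoc,
    huv, hvu, huv', hvu', hP, hP', mul_one, one_mul, mul_zero, zero_mul, smul_zero, smul_sub,
    smul_add] at H1 H2
  have r1 : P * (v * (P * (u * P))) = l • (P * (v * P)) + l • (P * (u * P)) := by
    linear_combination (norm := module) -H1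
  have r2 : P * (u * (P * (v * P))) = l • (P * (v * P)) + l • (P * (u * P)) := by
    linear_combination (norm := module) H2
  have r1' : ∀ z, P * (v * (P * (u * (P * z)))) =
      l • (P * (v * (P * z))) + l • (P * (u * (P * z))) := fun z => by
    have := congrArg (fun y => y * z) r1
    simpa only [mul_add, add_mul, mul_sub, sub_mul, smul_mul_assoc, mul_smul_comm, mul_assoc,
    huv, hvu, huv', hvu', hP, hP', mul_one, one_mul, mul_zero, zero_mul, smul_zero, smul_sub,
    smul_add] using this
  have r2' : ∀ z, P * (u * (P * (v * (P * z)))) =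
      l • (P * (v * (P * z))) + l • (P * (u * (P * z))) := fun z => by
    have := congrArg (fun y => y * z) r2
    simpa only [mul_add, add_mul, mul_sub, sub_mul, smul_mul_assoc, mul_smul_comm, mul_assoc,
    huv, hvu, huv', hvu', hP, hP', mul_one, one_mul, mul_zero, zero_mul, smul_zero, smul_sub,
    smul_add] using this
  obtain ⟨T, hT⟩ : ∃ T, T = u * P * v * P - P * v * P * u + l • (P * v - v * P)
      + l • (P * u - u * P) := ⟨_, rfl⟩
  rw [← hT]
  have canL : ∀ z, (P * u - l • 1) * z = 0 → z = 0 := by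
    intro z hz
    have h1 : l • z = P * (u * z) := by
      have := hz
      simp only [mul_add, add_mul, mul_sub, sub_mul, smul_mul_assoc, mul_smul_comm, mul_assoc,
    huv, hvu, huv', hvu', hP, hP', mul_one, one_mul, mul_zero, zero_mul, smul_zero, smul_sub,
    smul_add] at this
      linear_combination (norm := module) -this
    have h3 : (P * v - l • 1) * ((P * u - l • 1) * (P * (u * z))) = - (P * (u * z)) := by
      simp only [mul_add, add_mul, mul_sub, sub_mul, smul_mul_assoc, mul_smul_comm, mul_assoc,
    huv, hvu, huv', hvu', hP, hP', mul_one, one_mul, mul_zero, zero_mul, smul_zero, smul_sub,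
    smul_add, r1']
      match_scalars <;> first | ring1 | linear_combination hl
    rw [← h1, mul_smul_comm, hz] at h3
    simp only [smul_zero, mul_zero] at h3
    have h4 := neg_eq_zero.1 h3.symm
    exact (smul_eq_zero.1 h4).resolve_left hl0
  have canR : ∀ z, z * (u * P - l • 1) = 0 → z = 0 := by
    intro z hz
    have h1 : l • z = z * (u * P) := by
      have := hz
      simp only [mul_add, add_mul, mul_sub, sub_mul, smul_mul_assoc, mul_smul_comm, mul_assoc,
    huv, hvu, huv', hvu', hP, hP', mul_one, one_mul, mul_zero, zero_mul, smul_zero, smul_sub,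
    smul_add] at this
      linear_combination (norm := module) -this
    have h3 : z * (u * P) * (u * P - l • 1) * (v * P - l • 1) = - (z * (u * P)) := by
      simp only [mul_add, add_mul, mul_sub, sub_mul, smul_mul_assoc, mul_smul_comm, mul_assoc,
    huv, hvu, huv', hvu', hP, hP', mul_one, one_mul, mul_zero, zero_mul, smul_zero, smul_sub,
    smul_add, r2]
      match_scalars <;> first | ring1 | linear_combination hl
    rw [← h1, smul_mul_assoc, hz] at h3
    simp only [smul_zero, zero_mul] at h3
    have h4 := neg_eq_zero.1 h3.symm
    exact (smul_eq_zero.1 h4).resolve_left hl0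
  apply canR
  apply canL
  rw [hT]
  simp only [mul_add, add_mul, mul_sub, sub_mul, smul_mul_assoc, mul_smul_comm, mul_assoc,
    huv, hvu, huv', hvu', hP, hP', mul_one, one_mul, mul_zero, zero_mul, smul_zero, smul_sub,
    smul_add, r1, r2, r1', r2'] at H ⊢
  refine Eq.trans ?_ H
  match_scalars <;> first | ring1 | grind

/-- Special spectral point, `s ≠ 0`. -/
theorem aux_s {F : Type*} [Field F] {A : Type*} [Ring A] [Algebra F A]
    (l m : F) (hlm : l * m = 1) (hs : l + m ≠ 0) (P u v : A) (huv : u * v = 1) (hvu : v * u = 1)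
    (hP : P * P = (l + m) • P)
    (H : P * u * P * v - v * P * u * P - m • (v * P - P * v) + (l + m) • (v * P * u - u * P * v)
      + l • (u * P - P * u) = 0) :
    u * P * v * P - P * v * P * u - m • (P * v - v * P) + l • (P * u - u * P) = 0 := by
  have huv' : ∀ z, u * (v * z) = z := fun z => by rw [← mul_assoc, huv, one_mul]
  have hvu' : ∀ z, v * (u * z) = z := fun z => by rw [← mul_assoc, hvu, one_mul]
  have hP' : ∀ z, P * (P * z) = (l + m) • (P * z) := fun z => by
    rw [← mul_assoc, hP, smul_mul_assoc]
  have key : (P * u * P) * (P * v * P) = (P * v * P) * (P * u * P) := by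
    obtain ⟨Q, hQ⟩ : ∃ Q, Q = (l + m) • (P * u * u * P) - P * u * P * u * P - m • (P * u * P) :=
      ⟨_, rfl⟩
    obtain ⟨M, hM⟩ : ∃ M, M = P * v * P - l • P := ⟨_, rfl⟩
    have e1 : M * Q = (l + m) • (P * u * P - (m * (l + m) ^ 2) • P) := by
      have h := congrArg (fun z => (l + m) • (P * z * u * P)) H
      subst hQ hM
      simp only [mul_add, add_mul, mul_sub, sub_mul, smul_mul_assoc, mul_smul_comm, mul_assoc,
    huv, hvu, huv', hvu', hP, hP', mul_one, one_mul, mul_zero, zero_mul, smul_zero, smul_sub,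
    smul_add] at h ⊢
      rw [← sub_eq_zero]
      refine Eq.trans ?_ h
      match_scalars <;> first | ring1 | grind
    have e2 : Q * M = (l + m) • (P * u * P - (m * (l + m) ^ 2) • P) := by
      have h := congrArg (fun z => (-(l + m)) • (P * u * z * P)) H
      subst hQ hM
      simp only [mul_add, add_mul, mul_sub, sub_mul, smul_mul_assoc, mul_smul_comm, mul_assoc,
    huv, hvu, huv', hvu', hP, hP', mul_one, one_mul, mul_zero, zero_mul, smul_zero, smul_sub,
    smul_add] at h ⊢
      rw [← sub_eq_zero]
      refine Eq.trans ?_ h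
      match_scalars <;> first | ring1 | grind
    have e3 : M * Q * M = M * (Q * M) := mul_assoc _ _ _
    rw [e1, e2] at e3
    simp only [smul_mul_assoc, mul_smul_comm] at e3
    have e4 := smul_right_injective A hs e3
    subst hM
    simp only [mul_add, add_mul, mul_sub, sub_mul, smul_mul_assoc, mul_smul_comm, mul_assoc,
    huv, hvu, huv', hvu', hP, hP', mul_one, one_mul, mul_zero, zero_mul, smul_zero, smul_sub,
    smul_add] at e4 ⊢
    linear_combination (norm := module) e4
  have H1 := congrArg (fun z => P * z) H
  have H2 := congrArg (fun z => z * P) H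
  obtain ⟨T, hT⟩ : ∃ T, T = u * P * v * P - P * v * P * u - m • (P * v - v * P)
    + l • (P * u - u * P) := ⟨_, rfl⟩
  rw [← hT]
  have hPT : P * T = 0 := by
    subst hT
    simp only [mul_add, add_mul, mul_sub, sub_mul, smul_mul_assoc, mul_smul_comm, mul_assoc,
    huv, hvu, huv', hvu', hP, hP', mul_one, one_mul, mul_zero, zero_mul, smul_zero, smul_sub,
    smul_add] at H1 key ⊢
    have key' : P * (u * (P * (v * P))) = P * (v * (P * (u * P))) :=
      smul_right_injective A hs (by linear_combination (norm := module) key)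
    linear_combination (norm := module) key' - H1
  have hTP : P * T = (l + m) • T := by
    subst hT
    simp only [mul_add, add_mul, mul_sub, sub_mul, smul_mul_assoc, mul_smul_comm, mul_assoc,
    huv, hvu, huv', hvu', hP, hP', mul_one, one_mul, mul_zero, zero_mul, smul_zero, smul_sub,
    smul_add] at H2 ⊢
    first
      | linear_combination (norm := module) H2
      | linear_combination (norm := module) -H2
  rw [hPT] at hTP
  exact (smul_eq_zero.1 hTP.symm).resolve_left hs

theorem aux_special {F : Type*} [Field F] {A : Type*} [Ring A] [Algebra F A]
    (l m : F) (hlm : l * m = 1) (P u v : A) (huv : u * v = 1) (hvu : v * u = 1)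
    (hP : P * P = (l + m) • P)
    (H : P * u * P * v - v * P * u * P - m • (v * P - P * v) + (l + m) • (v * P * u - u * P * v)
      + l • (u * P - P * u) = 0) :
    u * P * v * P - P * v * P * u - m • (P * v - v * P) + l • (P * u - u * P) = 0 := by
  by_cases hs : l + m = 0
  · have hm : m = -l := by linear_combination hs
    subst hm
    have := aux_nil l (by linear_combination -hlm) P u v huv hvu (by simpa using hP)
      (by linear_combination (norm := module) H)
    linear_combination (norm := module) this
  · exact aux_s l m hlm hs P u v huv hvu hP H

theorem aux_core {F : Type*} [Field F] {A : Type*} [Ring A] [Algebra F A]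
    (w k : F) (b u v : A) (huv : u * v = 1) (hvu : v * u = 1)
    (hb : b * b = w • b + 1)
    (H : (b - (w + k) • 1 + k • u) * u * b * (1 - u)
      - (1 - u) * b * u * (b - (w + k) • 1 + k • u) = 0) :
    (b - (w + k) • 1 + k • u) * v * b * (1 - u)
      - (1 - u) * b * v * (b - (w + k) • 1 + k • u) = 0 := by
  have huv' : ∀ z, u * (v * z) = z := fun z => by rw [← mul_assoc, huv, one_mul]
  have hvu' : ∀ z, v * (u * z) = z := fun z => by rw [← mul_assoc, hvu, one_mul]
  have hb' : ∀ z, b * (b * z) = w • (b * z) + z := fun z => by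
    rw [← mul_assoc, hb, add_mul, smul_mul_assoc, one_mul]
  have H0 : v * _ * v = v * 0 * v := congrArg (fun z => v * z * v) H
  by_cases hk : k * (k + w) = 1
  · have := aux_special (-k) (-k - w) (by linear_combination hk) (b + (-k - w) • 1) u v huv hvu
      (by
        simp only [mul_add, add_mul, smul_mul_assoc, mul_smul_comm, mul_one, one_mul, hb]
        match_scalars
        · ring
        · linear_combination -hk)
      (by
        simp only [mul_add, add_mul, mul_sub, sub_mul, smul_mul_assoc, mul_smul_comm, mul_assoc,
          huv, hvu, huv', hvu', hb, hb', mul_one, one_mul, mul_zero, zero_mul] at H0 ⊢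
        rw [← sub_eq_zero] at H0
        rw [← H0]
        match_scalars <;> first | ring1 | linear_combination hk | linear_combination -hk)
    rw [← this]
    simp only [mul_add, add_mul, mul_sub, sub_mul, smul_mul_assoc, mul_smul_comm, mul_assoc,
          huv, hvu, huv', hvu', hb, hb', mul_one, one_mul, mul_zero, zero_mul]
    match_scalars <;> first | ring1 | linear_combination hk | linear_combination -hk
  · obtain ⟨T, hT⟩ : ∃ T, T = (b - (w + k) • 1 + k • u) * v * b * (1 - u)
      - (1 - u) * b * v * (b - (w + k) • 1 + k • u) := ⟨_, rfl⟩
    rw [← hT]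
    have H1 := congrArg (fun z => z * b) H0
    have e : k • T + b * T = 0 := by
      subst hT
      simp only [mul_add, add_mul, mul_sub, sub_mul, smul_mul_assoc, mul_smul_comm, mul_assoc,
          huv, hvu, huv', hvu', hb, hb', mul_one, one_mul, mul_zero, zero_mul] at H0 H1 ⊢
      linear_combination (norm := module) (-(k + w)) • H0 + H1
    have e2 := congrArg (fun z => b * z) e
    simp only [mul_add, mul_smul_comm, hb', mul_zero] at e2
    have e3 : (1 - k * (k + w)) • T = 0 := by
      linear_combination (norm := module) e2 - (k + w) • e
    rcases smul_eq_zero.1 e3 with h | h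
    · exact absurd (by linear_combination -h) hk
    · exact h

/-- Relation (4.23) of the paper: under the Hecke relation for `e₁` and the
boundary relation for `e₀`, the Baxterised `K̂(x)` satisfies
`e₁K̂(x)e₁e₀ − e₀e₁K̂(x)e₁ = ω((e₀+1)K̂(x)e₁e₀ − e₀e₁(e₀+1)K̂(x))`. -/
theorem boundary_relation_K_exchange
    {F : Type*} [Field F] [CharZero F] {A : Type*} [Ring A] [Algebra F A]
    (ω : F) (e₀ e₁ : A)
    (hHecke : e₁ * e₁ = ω • e₁ + 1)
    (hbdry : e₁ * e₀ * e₁ * e₀ - e₀ * e₁ * e₀ * e₁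
        = ω • (e₀ ^ 2 * e₁ * e₀ - e₀ * e₁ * e₀ ^ 2))
    (x : F) (hx : x ≠ 0)
    (hU : IsUnit ((1 : A) - (x⁻¹ - 1) • e₀))
    (K : A)
    (hK : K = ((1 : A) - (x - 1) • e₀) *
        Ring.inverse ((1 : A) - (x⁻¹ - 1) • e₀)) :
    e₁ * K * e₁ * e₀ - e₀ * e₁ * K * e₁
      = ω • ((e₀ + 1) * K * e₁ * e₀ - e₀ * e₁ * (e₀ + 1) * K) := by
  have hb' : ∀ z, e₁ * (e₁ * z) = ω • (e₁ * z) + z := fun z => by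
    rw [← mul_assoc, hHecke, add_mul, smul_mul_assoc, one_mul]
  obtain ⟨c, hc⟩ : ∃ c, c = x⁻¹ - 1 := ⟨_, rfl⟩
  rw [← hc] at hU hK
  obtain ⟨u, hu⟩ : ∃ u, u = (1 : A) - c • e₀ := ⟨_, rfl⟩
  rw [← hu] at hU hK
  have huv := Ring.mul_inverse_cancel u hU
  have hvu := Ring.inverse_mul_cancel u hU
  obtain ⟨v, hv⟩ : ∃ v, v = Ring.inverse u := ⟨_, rfl⟩
  rw [← hv] at huv hvu hK
  have hnum : (1 : A) - (x - 1) • e₀ = (1 + x) • 1 - x • u := by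
    rw [hu, hc]
    match_scalars
    · ring
    · field_simp
      ring
  rw [hnum, sub_mul, smul_mul_assoc, smul_mul_assoc, one_mul, huv] at hK
  by_cases hc0 : c = 0
  · have hu1 : u = 1 := by rw [hu, hc0]; simp
    have hv1 : v = 1 := by rw [hu1] at huv; simpa using huv
    have hK1 : K = 1 := by rw [hK, hv1]; module
    subst hK1
    simp only [mul_add, add_mul, mul_sub, sub_mul, smul_mul_assoc, mul_smul_comm, mul_assoc,
      hHecke, hb', mul_one, one_mul]
    module
  have ha : e₀ = c⁻¹ • (1 - u) := by
    rw [hu, sub_sub_cancel, smul_smul, inv_mul_cancel₀ hc0, one_smul]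
  have huv' : ∀ z, u * (v * z) = z := fun z => by rw [← mul_assoc, huv, one_mul]
  have hvu' : ∀ z, v * (u * z) = z := fun z => by rw [← mul_assoc, hvu, one_mul]
  clear hu hv hnum hU hc
  subst ha
  have := aux_core ω (ω * c⁻¹) e₁ u v huv hvu hHecke (by
    have h := congrArg (fun z => (-c ^ 2) • z) hbdry
    simp only [pow_two, mul_add, add_mul, mul_sub, sub_mul, smul_mul_assoc, mul_smul_comm, mul_assoc,
      hHecke, hb', mul_one, one_mul] at h ⊢
    rw [← sub_eq_zero] at h
    rw [← h]
    match_scalars <;> field_simp <;> ring)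
  subst hK
  rw [← sub_eq_zero]
  have h2 := congrArg (fun z => ((1 + x) * c⁻¹) • z) this
  simp only [smul_zero] at h2
  rw [← h2]
  simp only [mul_add, add_mul, mul_sub, sub_mul, smul_mul_assoc, mul_smul_comm, mul_assoc,
      huv, hvu, huv', hvu', hHecke, hb', mul_one, one_mul]
  match_scalars <;> field_simp <;> ring
end

section
/- Let A be a unital associative algebra over a field F of characteristic zero, ω ∈ F, and e₀, e₁ ∈ A with e₁² = ω·e₁ + 1 and e₁e₀e₁e₀ − e₀e₁e₀e₁ = ω·(e₀²e₁e₀ − e₀e₁e₀²). Assume 1 + e₀ is invertible and set ē₀ = e₀·(1 + e₀)⁻¹. Then ē₀ satisfies the boundary braid relation e₁·ē₀·e₁·ē₀ = ē₀·e₁·ē₀·e₁. -/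
/-- If `e₀` satisfies the boundary relation
`e₁e₀e₁e₀ − e₀e₁e₀e₁ = ω(e₀²e₁e₀ − e₀e₁e₀²)` and `1 + e₀` is invertible, then
`ē₀ = e₀(1 + e₀)⁻¹` satisfies the boundary braid relation `e₁ē₀e₁ē₀ = ē₀e₁ē₀e₁`. -/
theorem boundary_relation_gives_boundary_braid
    {F : Type*} [Field F] [CharZero F] {A : Type*} [Ring A] [Algebra F A]
    (ω : F) (e₀ e₁ : A)
    (hHecke : e₁ * e₁ = ω • e₁ + 1)
    (hbdry : e₁ * e₀ * e₁ * e₀ - e₀ * e₁ * e₀ * e₁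
        = ω • (e₀ ^ 2 * e₁ * e₀ - e₀ * e₁ * e₀ ^ 2))
    (hU : IsUnit ((1 : A) + e₀))
    (ebar₀ : A) (hebar₀ : ebar₀ = e₀ * Ring.inverse ((1 : A) + e₀)) :
    e₁ * ebar₀ * e₁ * ebar₀ = ebar₀ * e₁ * ebar₀ * e₁ := by
  obtain ⟨v, hv⟩ := hU
  rw [← hv, Ring.inverse_unit] at hebar₀
  obtain ⟨v, u, hvu, huv⟩ := v
  simp only [Units.inv_mk] at hebar₀ hv
  have hx : e₀ = v - 1 := by rw [hv]; abel
  have hy : ebar₀ = 1 - u := by rw [hebar₀, hx, sub_mul, one_mul]; exact congrArg (· - u) hvu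
  have h1 : ∀ z : A, e₁ * (e₁ * z) = ω • (e₁ * z) + z := fun z => by
    rw [← mul_assoc, hHecke, add_mul, smul_mul_assoc, one_mul]
  have h2 : ∀ z : A, v * (u * z) = z := fun z => by rw [← mul_assoc, hvu, one_mul]
  have h3 : ∀ z : A, u * (v * z) = z := fun z => by rw [← mul_assoc, huv, one_mul]
  have key : e₁ * ebar₀ * e₁ * ebar₀ - ebar₀ * e₁ * ebar₀ * e₁
      = - (u * e₁ * u * ((e₁ * e₀ * e₁ * e₀ - e₀ * e₁ * e₀ * e₁)
        - ω • (e₀ ^ 2 * e₁ * e₀ - e₀ * e₁ * e₀ ^ 2)) * (u * e₁ * u)) := by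
    rw [hx, hy]
    simp only [pow_two, mul_sub, sub_mul, mul_add, add_mul, mul_one, one_mul, mul_assoc,
      smul_mul_assoc, mul_smul_comm, smul_sub, smul_add, h1, h2, h3, hHecke, hvu, huv]
    module
  rw [hbdry, sub_self, mul_zero, zero_mul, neg_zero] at key
  exact sub_eq_zero.mp key
end

section
/- Let A be a unital associative algebra over a field F of characteristic zero, ω ∈ F, e₁ ∈ A with e₁² = ω·e₁ + 1, and let ē₀ ∈ A satisfy the boundary braid relation e₁·ē₀·e₁·ē₀ = ē₀·e₁·ē₀·e₁. Set Ř(x) = (x − 1)·e₁ + ω·1, and for nonzero x ∈ F with 1 − (1/x)·ē₀ invertible set K̂(x) = (1 − x·ē₀)·(1 − (1/x)·ē₀)⁻¹. Then for all nonzero x₁, x₂ ∈ F such that 1 − (1/x₁)·ē₀ and 1 − (1/x₂)·ē₀ are invertible, the braided reflection equation holds: Ř(x₁/x₂)·K̂(x₁)·Ř(x₁x₂)·K̂(x₂) = K̂(x₂)·Ř(x₁x₂)·K̂(x₁)·Ř(x₁/x₂). -/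
theorem bb_expand_aux {Z A : Type*} [CommRing Z] [Ring A] [Algebra Z A] (e d k n : A)
    (a c o : Z) (h : d * k * n = n * k * d) (h1 : k * n = n * k) (h2 : d * k = k * d) :
    d * (a • e + o • 1) * k * (c • e + o • 1) * n - n * (c • e + o • 1) * k * (a • e + o • 1) * d
    = (a * c) • (d * (e * k * e) * n - n * (e * k * e) * d)
      + (a * o) • (d * e * (k * n) - (k * n) * e * d)
      + (o * c) • ((d * k) * e * n - n * e * (d * k)) := by
  rw [h1, h2]
  simp only [mul_add, add_mul, mul_sub, sub_mul, smul_mul_assoc, mul_smul_comm, smul_sub,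
    mul_one, one_mul, smul_smul, smul_add]
  rw [h]
  have h3 : d * e * k * n = d * e * (n * k) := by rw [mul_assoc, h1]
  have h4 : n * e * k * d = n * e * (k * d) := by rw [mul_assoc]
  rw [h2, h3, h4]
  simp only [← mul_assoc]
  module

theorem bb_expand {A : Type*} [Ring A] (e d k n : A)
    (a c o : A) (ha : ∀ y, Commute a y) (hc : ∀ y, Commute c y) (ho : ∀ y, Commute o y)
    (h : d * k * n = n * k * d) (h1 : k * n = n * k) (h2 : d * k = k * d) :
    d * (a * e + o) * k * (c * e + o) * n - n * (c * e + o) * k * (a * e + o) * d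
    = (a * c) * (d * (e * k * e) * n - n * (e * k * e) * d)
      + (a * o) * (d * e * (k * n) - (k * n) * e * d)
      + (o * c) * ((d * k) * e * n - n * e * (d * k)) := by
  have ma : a ∈ Subring.center A := Subring.mem_center_iff.mpr fun y => (ha y).symm.eq
  have mc : c ∈ Subring.center A := Subring.mem_center_iff.mpr fun y => (hc y).symm.eq
  have mo : o ∈ Subring.center A := Subring.mem_center_iff.mpr fun y => (ho y).symm.eq
  have := bb_expand_aux (Z := Subring.center A) e d k n ⟨a, ma⟩ ⟨c, mc⟩ ⟨o, mo⟩ h h1 h2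
  simpa [Subring.smul_def] using this

theorem bb_units {A : Type*} [Ring A] (v : Aˣ) (r k r' n : A)
    (cn : Commute n (↑v⁻¹ : A))
    (h : ↑v * r * k * r' * n = n * r' * k * r * ↑v) :
    r * k * r' * (n * (↑v⁻¹ : A)) = n * (↑v⁻¹ : A) * r' * k * r := by
  calc r * k * r' * (n * (↑v⁻¹ : A))
      = (↑v⁻¹ * ↑v) * (r * k * r' * n) * (↑v⁻¹ : A) := by
        rw [Units.inv_mul, one_mul]; simp only [mul_assoc]
    _ = ↑v⁻¹ * (↑v * r * k * r' * n) * (↑v⁻¹ : A) := by simp only [mul_assoc]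
    _ = (↑v⁻¹ * n) * r' * k * r * (↑v * (↑v⁻¹ : A)) := by rw [h]; simp only [mul_assoc]
    _ = _ := by rw [← cn.eq, Units.mul_inv, mul_one]

theorem bb_core {S A : Type*} [CommRing S] [Ring A] (φ : S →+* A) (e : A)
    (b J P x xi w wi om : S)
    (hx : x * xi = 1) (hw : w * wi = 1)
    (hP : P * (1 - xi * b) = 1)
    (zx : ∀ y, Commute y (φ x)) (zxi : ∀ y, Commute y (φ xi)) (zw : ∀ y, Commute y (φ w))
    (zwi : ∀ y, Commute y (φ wi)) (zom : ∀ y, Commute y (φ om))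
    (hee : e * e = φ om * e + 1)
    (hJ : φ J = e * φ b * e) :
    φ (1 - wi * b) * (φ (x * wi - 1) * e + φ om) * φ ((1 - x * b) * P) *
      (φ (x * w - 1) * e + φ om) * φ (1 - w * b)
    = φ (1 - w * b) * (φ (x * w - 1) * e + φ om) * φ ((1 - x * b) * P) *
      (φ (x * wi - 1) * e + φ om) * φ (1 - wi * b) := by
  have cx := zx e
  have cxi := zxi e
  have cw := zw e
  have cwi := zwi e
  have com := zom e
  have heb : e * φ b = φ J * e - φ (om * J) := by
    have : φ (om * J) = e * φ b * (φ om * e) := by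
      rw [mul_comm om J, map_mul, hJ, mul_assoc (e * φ b), com.eq]
    rw [this, hJ, mul_assoc (e * φ b), hee]; noncomm_ring
  have hbe : φ b * e = e * φ J - φ (om * J) := by
    have : φ (om * J) = φ om * e * (φ b * e) := by
      rw [map_mul, hJ]; noncomm_ring
    have h2 : e * φ J = e * e * (φ b * e) := by rw [hJ]; noncomm_ring
    rw [this, h2, hee]; noncomm_ring
  have hcom : ∀ u v : S, φ u * φ v = φ v * φ u := fun u v => by
    rw [← map_mul, ← map_mul, mul_comm]
  -- moving e past a linear polynomial
  have hlin : ∀ t : S, Commute e (φ t) →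
      e * φ (1 - t * b) = φ (1 - t * J) * e + φ (t * om * J) := by
    intro t ht
    have : e * φ (t * b) = φ (t * J) * e - φ (t * om * J) := by
      rw [map_mul, ← mul_assoc, ht.eq, mul_assoc, heb, mul_sub, ← mul_assoc, ← map_mul,
        ← map_mul, ← mul_assoc t]
    rw [map_sub, mul_sub, this, map_sub, map_one]; noncomm_ring
  have hPe : φ (1 - xi * J) * e * φ P = e - φ (om * xi * J * P) := by
    have h1 : φ (1 - xi * J) * e = e * φ (1 - xi * b) - φ (xi * om * J) := by
      rw [hlin xi cxi]; abel
    rw [h1, sub_mul, mul_assoc, ← map_mul, ← map_mul, mul_comm _ P, hP, map_one, mul_one]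
    congr 2; ring
  have hKe : φ (1 - xi * J) * e * φ ((1 - x * b) * P)
      = φ (1 - x * J) * e + φ (- (1 - x * J) * om * xi * J * P
          + x * om * J * (1 - xi * J) * P) := by
    have h1 : φ (1 - xi * J) * e * φ ((1 - x * b) * P)
        = φ (1 - x * J) * (φ (1 - xi * J) * e * φ P)
          + φ ((1 - xi * J) * (x * om * J) * P) := by
      rw [map_mul φ (1 - x * b) P, mul_assoc (φ _) e, ← mul_assoc e, hlin x cx]
      have := hcom (1 - xi * J) (1 - x * J)
      rw [add_mul, mul_add, ← mul_assoc, ← mul_assoc, ← mul_assoc, this,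
        map_mul φ _ P, map_mul φ (1 - xi * J)]
      noncomm_ring
    rw [h1, hPe, mul_sub, ← map_mul, sub_add, ← map_sub, sub_eq_add_neg, ← map_neg]
    congr 2; ring
  have hmul : ∀ p q s : S, Commute e (φ s) →
      (φ p * e + φ q) * (φ s * e + φ om)
      = φ (p * s * om + p * om + q * s) * e + φ (p * s + q * om) := by
    intro p q s hs
    have h1 : φ p * e * (φ s * e) = φ p * φ s * (e * e) := by
      rw [mul_assoc (φ p) e, ← mul_assoc e, hs.eq]; noncomm_ring
    have h2 : φ p * e * φ om = φ p * φ om * e := by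
      rw [mul_assoc, com.eq]; noncomm_ring
    rw [add_mul, mul_add, mul_add, h1, h2, hee]
    simp only [map_add, map_mul]
    noncomm_ring
  have hmulr : ∀ p q t : S, Commute e (φ t) →
      (φ p * e + φ q) * φ (1 - t * b)
      = φ (p * (1 - t * J)) * e + φ (p * (t * om * J) + q * (1 - t * b)) := by
    intro p q t ht
    rw [add_mul, mul_assoc, hlin t ht]
    simp only [map_add, map_mul]
    noncomm_ring
  have hfull : ∀ l s s' t : S, Commute e (φ s) → Commute e (φ s') → Commute e (φ t) →
      ∀ p q, p = s * (1 - x * J) →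
      q = s * (- (1 - x * J) * om * xi * J * P
          + x * om * J * (1 - xi * J) * P) + (1 - xi * J) * om * ((1 - x * b) * P) →
      φ (1 - xi * J) * (φ l * (φ s * e + φ om) * φ ((1 - x * b) * P) *
        (φ s' * e + φ om) * φ (1 - t * b))
      = φ (l * ((p * s' * om + p * om + q * s') * (1 - t * J))) * e
        + φ (l * ((p * s' * om + p * om + q * s') * (t * om * J)
            + (p * s' + q * om) * (1 - t * b))) := by
    intro l s s' t hs hs' ht p q hp hq
    have h1 : φ (1 - xi * J) * (φ s * e + φ om) * φ ((1 - x * b) * P) = φ p * e + φ q := by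
      have : φ (1 - xi * J) * (φ s * e + φ om) * φ ((1 - x * b) * P)
          = φ s * (φ (1 - xi * J) * e * φ ((1 - x * b) * P))
            + φ ((1 - xi * J) * om * ((1 - x * b) * P)) := by
        rw [mul_add, ← mul_assoc, hcom _ s, map_mul φ (_ * om), map_mul φ _ om]
        noncomm_ring
      rw [this, hKe, hp, hq, mul_add, ← mul_assoc, ← map_mul, ← map_mul, add_assoc, ← map_add]
    calc _ = φ l * ((φ (1 - xi * J) * (φ s * e + φ om) * φ ((1 - x * b) * P)) *
        (φ s' * e + φ om) * φ (1 - t * b)) := by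
          simp only [← mul_assoc]; rw [hcom _ l]
      _ = _ := by
          rw [h1, hmul p q s' hs', hmulr _ _ t ht, mul_add, ← mul_assoc, ← map_mul, ← map_mul]
  have c1 : Commute e (φ 1) := by rw [map_one]; exact Commute.one_right e
  have ca : Commute e (φ (x * wi - 1)) := by
    rw [map_sub, map_mul]; exact (cx.mul_right cwi).sub_right c1
  have cb : Commute e (φ (x * w - 1)) := by
    rw [map_sub, map_mul]; exact (cx.mul_right cw).sub_right c1
  -- first: D2 * E = 0
  have hD : φ (1 - xi * J) * (φ (1 - wi * b) * (φ (x * wi - 1) * e + φ om) *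
      φ ((1 - x * b) * P) * (φ (x * w - 1) * e + φ om) * φ (1 - w * b))
    = φ (1 - xi * J) * (φ (1 - w * b) * (φ (x * w - 1) * e + φ om) * φ ((1 - x * b) * P) *
      (φ (x * wi - 1) * e + φ om) * φ (1 - wi * b)) := by
    rw [hfull _ _ _ _ ca cb cw _ _ rfl rfl, hfull _ _ _ _ cb ca cwi _ _ rfl rfl]
    congr 1
    · congr 2
      grind
    · congr 1
      grind
  -- second: D2 * E = E * D1
  have key : ∀ g : A, Commute g (φ (b + J)) → Commute g (φ (b * J)) →
      φ J * (g * φ b - φ b * g) = (g * φ b - φ b * g) * φ b := by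
    intro g h1 h2
    have h1 : g * (φ b + φ J) = (φ b + φ J) * g := by rw [← map_add]; exact h1.eq
    have h2 : g * (φ b * φ J) = φ b * φ J * g := by rw [← map_mul]; exact h2.eq
    have h3 := hcom b J
    have h4 : φ J * g = g * φ b + g * φ J - φ b * g := by
      rw [← mul_add, h1, add_mul]; abel
    have h5 : φ J * φ b * g = g * (φ b * φ J) := by rw [h2, h3]
    rw [mul_sub, ← mul_assoc, ← mul_assoc, h4, h5, h3, sub_mul, add_mul]
    rw [mul_assoc g (φ J), sub_mul]; abel
  have ceJ : Commute e (φ (b + J)) := by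
    show e * _ = _ * e
    rw [map_add, mul_add, add_mul, heb, hbe]; abel
  have ceN : Commute e (φ (b * J)) := by
    show e * _ = _ * e
    have h : φ b * φ J = φ J * φ b := hcom b J
    calc e * φ (b * J) = e * φ b * φ J := by rw [map_mul, mul_assoc]
      _ = φ J * (e * φ J - φ (om * J)) := by
        rw [heb, sub_mul, mul_sub, mul_assoc, hcom J (om * J)]
      _ = φ (b * J) * e := by rw [← hbe, map_mul, h, mul_assoc]
  let Q : A → Prop := fun c => φ J * c = c * φ b
  have Qadd : ∀ c d, Q c → Q d → Q (c + d) := by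
    intro c d hc hd
    show φ J * (c + d) = (c + d) * φ b
    rw [mul_add, add_mul, hc, hd]
  have Qneg : ∀ c, Q c → Q (-c) := by
    intro c hc
    show φ J * (-c) = (-c) * φ b
    rw [mul_neg, neg_mul, hc]
  have Ql : ∀ u c, Q c → Q (φ u * c) := by
    intro u c hc
    show φ J * (φ u * c) = φ u * c * φ b
    rw [← mul_assoc, hcom J u, mul_assoc, hc, mul_assoc]
  have Qr : ∀ u c, Q c → Q (c * φ u) := by
    intro u c hc
    show φ J * (c * φ u) = c * φ u * φ b
    rw [← mul_assoc, hc, mul_assoc, hcom b u, mul_assoc]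
  -- commutators
  have Qz : Q 0 := by show φ J * 0 = 0 * φ b; simp
  have Cscal : ∀ g u, Commute g (φ u) → Q (g * φ u - φ u * g) := by
    intro g u h; rw [h.eq, sub_self]; exact Qz
  have Cmul : ∀ g u v, Q (g * φ u - φ u * g) → Q (g * φ v - φ v * g) →
      Q (g * φ (u * v) - φ (u * v) * g) := by
    intro g u v hu hv
    have : g * φ (u * v) - φ (u * v) * g
        = (g * φ u - φ u * g) * φ v + φ u * (g * φ v - φ v * g) := by
      rw [map_mul]; noncomm_ring
    rw [this]; exact Qadd _ _ (Qr _ _ hu) (Ql _ _ hv)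
  have Clin : ∀ g t, Commute g (φ t) → Q (g * φ b - φ b * g) →
      Q (g * φ (1 - t * b) - φ (1 - t * b) * g) := by
    intro g t ht hb
    have : g * φ (1 - t * b) - φ (1 - t * b) * g = -(g * φ (t * b) - φ (t * b) * g) := by
      rw [map_sub, map_one]; noncomm_ring
    rw [this]; exact Qneg _ (Cmul _ _ _ (Cscal _ _ ht) hb)
  have CP : ∀ g, Commute g (φ xi) → Q (g * φ b - φ b * g) → Q (g * φ P - φ P * g) := by
    intro g hg hb
    have h1 : φ P * φ (1 - xi * b) = 1 := by rw [← map_mul, hP, map_one]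
    have h2 : φ (1 - xi * b) * φ P = 1 := by rw [hcom, h1]
    have : g * φ P - φ P * g
        = -(φ P * (g * φ (1 - xi * b) - φ (1 - xi * b) * g) * φ P) := by
      have h3 : φ P * (g * φ (1 - xi * b) - φ (1 - xi * b) * g) * φ P
        = φ P * g * (φ (1 - xi * b) * φ P) - (φ P * φ (1 - xi * b)) * g * φ P := by
          noncomm_ring
      rw [h3, h1, h2]; noncomm_ring
    rw [this]; exact Qneg _ (Qr _ _ (Ql _ _ (Clin _ _ hg hb)))
  have Cpair : ∀ g u v, Q (g * φ u - φ u * g) → Q (g * φ v - φ v * g) →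
      Q (φ u * g * φ v - φ v * g * φ u) := by
    intro g u v hu hv
    have : φ u * g * φ v - φ v * g * φ u
        = φ u * (g * φ v - φ v * g) + -(φ v * (g * φ u - φ u * g)) := by
      have := hcom u v
      rw [mul_sub, mul_sub, ← mul_assoc, ← mul_assoc, ← mul_assoc, ← mul_assoc, this]; abel
    rw [this]; exact Qadd _ _ (Ql _ _ hv) (Qneg _ (Ql _ _ hu))
  have Qeb := key e ceJ ceN
  set k := (1 - x * b) * P with hk
  have Qek : Q (e * φ k - φ k * e) := Cmul _ _ _ (Clin _ _ cx Qeb) (CP _ cxi Qeb)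
  have cS : ∀ u v, Commute e (φ u) → Commute (e * φ v * e) (φ u) := by
    intro u v h
    exact (h.mul_left (hcom v u)).mul_left h
  have Qgb := key (e * φ k * e) (cS _ _ ceJ) (cS _ _ ceN)
  have Qen := Clin e w cw Qeb
  have Qed := Clin e wi cwi Qeb
  have Q1 := Cpair (e * φ k * e) _ _ (Clin _ wi (cS _ _ cwi) Qgb) (Clin _ w (cS _ _ cw) Qgb)
  have Q2 := Cpair e (1 - wi * b) (k * (1 - w * b)) Qed (Cmul _ _ _ Qek Qen)
  have Q3 := Cpair e ((1 - wi * b) * k) (1 - w * b) (Cmul _ _ _ Qed Qek) Qen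
  set n := (1 - w * b) with hn
  set d := (1 - wi * b) with hd
  set α := x * wi - 1 with hα
  set β := x * w - 1 with hβ
  have hE : ∀ c d' : A, Q (c - d') → φ (1 - xi * J) * c = φ (1 - xi * J) * d' → c = d' := by
    intro c d' hq h
    have h1 : φ (1 - xi * J) * (c - d') = 0 := by rw [mul_sub, h, sub_self]
    have h2 : φ (1 - xi * J) * (c - d') = (c - d') * φ (1 - xi * b) := by
      rw [map_sub, map_sub, map_one, map_mul, map_mul, sub_mul, mul_sub (c - d'), mul_assoc, hq,
        ← mul_assoc (c - d'), (zxi (c - d')).eq, mul_assoc, one_mul, mul_one]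
    have h3 : (c - d') * (φ (1 - xi * b) * φ P) = 0 := by
      rw [← mul_assoc, ← h2, h1, zero_mul]
    rw [← map_mul, mul_comm _ P, hP, map_one, mul_one] at h3
    exact sub_eq_zero.mp h3
  apply hE _ _ _ hD
  have z1 : ∀ y : A, Commute y (φ 1) := fun y => by rw [map_one]; exact Commute.one_right y
  have za : ∀ y, Commute y (φ α) := fun y => by
    rw [hα, map_sub, map_mul]; exact ((zx y).mul_right (zwi y)).sub_right (z1 y)
  have zb : ∀ y, Commute y (φ β) := fun y => by
    rw [hβ, map_sub, map_mul]; exact ((zx y).mul_right (zw y)).sub_right (z1 y)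
  have hcdk : φ d * φ k * φ n = φ n * φ k * φ d := by
    rw [← map_mul, ← map_mul, ← map_mul, ← map_mul]; congr 1; ring
  rw [bb_expand e (φ d) (φ k) (φ n) (φ α) (φ β) (φ om) (fun y => (za y).symm)
    (fun y => (zb y).symm) (fun y => (zom y).symm) hcdk (hcom k n) (hcom d k),
    ← map_mul, ← map_mul, ← map_mul, ← map_mul, ← map_mul]
  exact Qadd _ _ (Qadd _ _ (Ql _ _ Q1) (Ql _ _ Q2)) (Ql _ _ Q3)

/-- Baxterisation from the boundary braid relation: if `e₁` satisfies the Hecke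
relation and `ē₀` satisfies `e₁ē₀e₁ē₀ = ē₀e₁ē₀e₁`, then
`K̂(x) = (1 − x·ē₀)(1 − (1/x)·ē₀)⁻¹` satisfies the braided reflection equation
with `Ř(x) = (x−1)e₁ + ω`. -/
theorem boundary_braid_baxterised_K_satisfies_reflection
    {F : Type*} [Field F] [CharZero F] {A : Type*} [Ring A] [Algebra F A]
    (ω : F) (ebar₀ e₁ : A)
    (hHecke : e₁ * e₁ = ω • e₁ + 1)
    (hbraid : e₁ * ebar₀ * e₁ * ebar₀ = ebar₀ * e₁ * ebar₀ * e₁)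
    (R : F → A) (hR : ∀ x : F, R x = (x - 1) • e₁ + ω • (1 : A))
    (K : F → A)
    (hK : ∀ x : F, K x = ((1 : A) - x • ebar₀) *
        Ring.inverse ((1 : A) - x⁻¹ • ebar₀)) :
    ∀ x₁ x₂ : F, x₁ ≠ 0 → x₂ ≠ 0 →
      IsUnit ((1 : A) - x₁⁻¹ • ebar₀) →
      IsUnit ((1 : A) - x₂⁻¹ • ebar₀) →
      R (x₁ / x₂) * K x₁ * R (x₁ * x₂) * K x₂
        = K x₂ * R (x₁ * x₂) * K x₁ * R (x₁ / x₂) := by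
  intro x₁ x₂ h1 h2 u1 u2
  obtain ⟨v1, hv1⟩ := u1
  obtain ⟨v2, hv2⟩ := u2
  rw [hK, hK, hR, hR, ← hv1, ← hv2, Ring.inverse_unit, Ring.inverse_unit]
  have cbJ : Commute ebar₀ (e₁ * ebar₀ * e₁) := by
    show ebar₀ * _ = _ * ebar₀
    rw [hbraid]; noncomm_ring
  have cbP : Commute ebar₀ (↑v1⁻¹ : A) := by
    apply Commute.units_inv_right
    rw [hv1]
    exact (Commute.one_right _).sub_right ((Commute.refl _).smul_right _)
  have cJP : Commute (e₁ * ebar₀ * e₁) (↑v1⁻¹ : A) := by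
    apply Commute.units_inv_right
    rw [hv1]
    exact (Commute.one_right _).sub_right (cbJ.symm.smul_right _)
  let s : Set A := {ebar₀, e₁ * ebar₀ * e₁, (↑v1⁻¹ : A)}
  have hs : ∀ a ∈ s, ∀ b ∈ s, a * b = b * a := by
    rintro a (rfl | rfl | rfl) b (rfl | rfl | rfl)
    · rfl
    · exact cbJ.eq
    · exact cbP.eq
    · exact cbJ.eq.symm
    · rfl
    · exact cJP.eq
    · exact cbP.eq.symm
    · exact cJP.eq.symm
    · rfl
  letI : CommRing (Algebra.adjoin F s) := Algebra.adjoinCommRingOfComm F hs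
  let φ : Algebra.adjoin F s →+* A := (Algebra.adjoin F s).val.toRingHom
  have hφ : ∀ y, φ y = (y : A) := fun y => rfl
  let b : Algebra.adjoin F s := ⟨ebar₀, Algebra.subset_adjoin (by simp [s])⟩
  let J : Algebra.adjoin F s := ⟨e₁ * ebar₀ * e₁, Algebra.subset_adjoin (by simp [s])⟩
  let P : Algebra.adjoin F s := ⟨(↑v1⁻¹ : A), Algebra.subset_adjoin (by simp [s])⟩
  let sc : F → Algebra.adjoin F s := fun t => ⟨algebraMap F A t, Subalgebra.algebraMap_mem _ t⟩
  have hb : φ b = ebar₀ := rfl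
  have hJ : φ J = e₁ * ebar₀ * e₁ := rfl
  have hPv : φ P = (↑v1⁻¹ : A) := rfl
  have hsc : ∀ t, φ (sc t) = algebraMap F A t := fun t => rfl
  have hinj : Function.Injective φ := Subtype.val_injective
  have zc : ∀ t y, Commute y (φ (sc t)) := fun t y => by
    rw [hsc]; exact (Algebra.commutes t y).symm
  have main := bb_core φ e₁ b J P (sc x₁) (sc x₁⁻¹) (sc x₂) (sc x₂⁻¹) (sc ω)
    (hinj (by rw [map_mul, hsc, hsc, ← map_mul, mul_inv_cancel₀ h1, map_one, map_one]))
    (hinj (by rw [map_mul, hsc, hsc, ← map_mul, mul_inv_cancel₀ h2, map_one, map_one]))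
    (hinj (by
      rw [map_mul, map_sub, map_mul, hsc, hb, hPv, map_one, ← Algebra.smul_def, ← hv1,
        Units.inv_mul]))
    (zc _) (zc _) (zc _) (zc _) (zc _)
    (by rw [hsc, ← Algebra.smul_def, hHecke]) hJ
  simp only [map_mul, map_sub, map_one, hsc, hb, hPv] at main
  simp only [← map_mul, ← Algebra.smul_def] at main
  have e1 : ∀ t : F, algebraMap F A t - 1 = algebraMap F A (t - 1) := fun t => by
    rw [map_sub, map_one]
  simp only [e1, ← Algebra.smul_def, Algebra.algebraMap_eq_smul_one ω] at main
  rw [← hv2, ← div_eq_mul_inv] at main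
  have cn : Commute (1 - x₂ • ebar₀) (↑v2⁻¹ : A) := by
    apply Commute.units_inv_right
    rw [hv2]
    exact (Commute.one_right _).sub_right
      (((Commute.one_left _).sub_left ((Commute.refl ebar₀).smul_left _)).smul_right _)
  exact bb_units v2 _ _ _ _ cn main
end

section
/- For every natural number N, the cardinality of the set of quintuples (s₁, s₂, f₂, f₁, c) with s₁, s₂, f₂, f₁ positive integers and c ∈ {0, 1}, satisfying 1 ≤ s₁ ≤ s₂ < f₂ ≤ f₁ ≤ N, f₁ − f₂ = s₂ − s₁, and the condition that c = 1 only if f₂ > s₂ + 1, equals the binomial coefficient C(N+1, 3). (This counts the integrable boundary conditions of the multi-species ASEP with N−1 species: each admissible choice of the four special species (s₁, s₂, f₂, f₁) gives one boundary matrix when f₂ = s₂ + 1 and two when f₂ > s₂ + 1.) -/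
def tripleFin (N : ℕ) : Finset (Σ _ : ℕ, Σ _ : ℕ, ℕ) :=
  (Finset.range (N + 1)).sigma fun c => (Finset.range c).sigma fun b => Finset.range b

lemma tripleFin_card (N : ℕ) : (tripleFin N).card = (N + 1).choose 3 := by
  have h1 : ∀ c : ℕ, ∑ b ∈ Finset.range c, b = c.choose 2 := by
    intro c
    induction c with
    | zero => simp
    | succ k ih =>
      rw [Finset.sum_range_succ, ih, Nat.choose_succ_succ' k 1, Nat.choose_one_right, add_comm]
  have h2 : ∀ c : ℕ, ∑ b ∈ Finset.range c, b.choose 2 = c.choose 3 := by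
    intro c
    induction c with
    | zero => simp
    | succ k ih =>
      rw [Finset.sum_range_succ, ih, Nat.choose_succ_succ' k 2, add_comm]
  simp only [tripleFin, Finset.card_sigma, Finset.card_range, h1, h2]

def tripleMap (p : Σ _ : ℕ, Σ _ : ℕ, ℕ) : ℕ × ℕ × ℕ × ℕ × ℕ :=
  (p.2.2 + 1, p.2.2 + 1 + (p.2.1 - p.2.2 - 1) / 2, p.1 - (p.2.1 - p.2.2 - 1) / 2, p.1,
    (p.2.1 - p.2.2 - 1) % 2)

/-- Counting of the integrable boundary conditions of the multi-species ASEP: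
the quintuples `(s₁, s₂, f₂, f₁, c)` with `1 ≤ s₁ ≤ s₂ < f₂ ≤ f₁ ≤ N`,
`f₁ − f₂ = s₂ − s₁`, `c ∈ {0, 1}` and `c = 1` only if `f₂ > s₂ + 1`,
number `C(N+1, 3)`. -/
theorem count_integrable_boundaries (N : ℕ) :
    Set.ncard {t : ℕ × ℕ × ℕ × ℕ × ℕ |
      1 ≤ t.1 ∧ t.1 ≤ t.2.1 ∧ t.2.1 < t.2.2.1 ∧ t.2.2.1 ≤ t.2.2.2.1 ∧
      t.2.2.2.1 ≤ N ∧ t.2.2.2.1 - t.2.2.1 = t.2.1 - t.1 ∧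
      (t.2.2.2.2 = 0 ∨ t.2.2.2.2 = 1) ∧
      (t.2.2.2.2 = 1 → t.2.1 + 1 < t.2.2.1)}
    = (N + 1).choose 3 := by
  rw [← tripleFin_card, ← Set.ncard_coe_finset]
  symm
  refine Set.ncard_congr (fun p _ => tripleMap p) ?_ ?_ ?_
  · rintro ⟨c, b, a⟩ h
    simp only [tripleFin, Finset.mem_coe, Finset.mem_sigma, Finset.mem_range] at h
    simp only [tripleMap, Set.mem_ofPred_eq]
    omega
  · rintro ⟨c, b, a⟩ ⟨c', b', a'⟩ h h' e
    simp only [tripleFin, Finset.mem_coe, Finset.mem_sigma, Finset.mem_range] at h h'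
    simp only [tripleMap, Prod.mk.injEq] at e
    obtain rfl : c = c' := by omega
    obtain rfl : a = a' := by omega
    obtain rfl : b = b' := by omega
    rfl
  · rintro ⟨s1, s2, f2, f1, e⟩ h
    simp only [Set.mem_ofPred_eq] at h
    refine ⟨⟨f1, s1 - 1 + 2 * (s2 - s1) + 1 + e, s1 - 1⟩, ?_, ?_⟩
    · simp only [tripleFin, Finset.mem_coe, Finset.mem_sigma, Finset.mem_range]
      omega
    · simp only [tripleMap, Prod.mk.injEq]
      have hk : s1 - 1 + 2 * (s2 - s1) + 1 + e - (s1 - 1) - 1 = 2 * (s2 - s1) + e := by omega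
      rw [hk]
      have h2 : (2 * (s2 - s1) + e) / 2 = s2 - s1 := by omega
      have h3 : (2 * (s2 - s1) + e) % 2 = e := by omega
      rw [h2, h3]
      refine ⟨?_, ?_, ?_, trivial, rfl⟩ <;> omega
end

section
/- Let A be a unital associative algebra over a field F of characteristic zero, and let α, γ, q ∈ F with α + γ ≠ 0 and q ≠ 1. Set α̃ = (α + γ + q − 1)·α/(α + γ) and γ̃ = (α + γ + q − 1)·γ/(α + γ). Suppose b₀, b₀⁺, b₀⁻ ∈ A satisfy: b₀² = −(α + γ̃)·b₀ + α̃·b₀⁺ + γ·b₀⁻; (b₀⁺)² = −γ·b₀⁺; (b₀⁻)² = −α̃·b₀⁻; b₀·b₀⁺ = b₀⁺·b₀ = −α·b₀⁺; b₀·b₀⁻ = b₀⁻·b₀ = −γ̃·b₀⁻; b₀⁺·b₀⁻ = b₀⁻·b₀⁺ = 0. Define e₀ = (b₀ + b₀⁺ + b₀⁻ + (α + γ + q − 1)·1)/(1 − q). Then e₀·(e₀ + 1)·(e₀ + α/(α + γ))·(e₀ + (α + γ + q − 1)/(q − 1)) = 0. -/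
/-- The quartic polynomial relation (4.36) of the paper: if `b₀, b₀⁺, b₀⁻`
satisfy the decomposition relations (4.32), then
`e₀ = (b₀ + b₀⁺ + b₀⁻ + (α+γ+q−1))/(1−q)` satisfies
`e₀(e₀+1)(e₀ + α/(α+γ))(e₀ + (α+γ+q−1)/(q−1)) = 0`. -/
theorem e0_quartic_polynomial_relation
    {F : Type*} [Field F] [CharZero F] {A : Type*} [Ring A] [Algebra F A]
    (α γ q : F) (hαγ : α + γ ≠ 0) (hq : q ≠ 1)
    (αt γt : F)
    (hαt : αt = (α + γ + q - 1) * α / (α + γ))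
    (hγt : γt = (α + γ + q - 1) * γ / (α + γ))
    (b₀ bp bm : A)
    (h1 : b₀ * b₀ = -((α + γt) • b₀) + αt • bp + γ • bm)
    (h2 : bp * bp = -(γ • bp))
    (h3 : bm * bm = -(αt • bm))
    (h4 : b₀ * bp = -(α • bp)) (h5 : bp * b₀ = -(α • bp))
    (h6 : b₀ * bm = -(γt • bm)) (h7 : bm * b₀ = -(γt • bm))
    (h8 : bp * bm = 0) (h9 : bm * bp = 0)
    (e₀ : A)
    (he₀ : e₀ = (1 - q)⁻¹ • (b₀ + bp + bm + (α + γ + q - 1) • (1 : A))) :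
    e₀ * (e₀ + 1) * (e₀ + (α / (α + γ)) • (1 : A))
      * (e₀ + ((α + γ + q - 1) / (q - 1)) • (1 : A)) = 0 := by
  have hq1 : (1 : F) - q ≠ 0 := sub_ne_zero.mpr (Ne.symm hq)
  have hq2 : q - 1 ≠ 0 := sub_ne_zero.mpr hq
  have hs : αt + γt = α + γ + q - 1 := by
    rw [hαt, hγt]; field_simp
  have hSp : (b₀ + bp + bm) * bp = -((α + γ) • bp) := by
    rw [add_mul, add_mul, h4, h2, h9]; module
  have hSm : (b₀ + bp + bm) * bm = -((αt + γt) • bm) := by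
    rw [add_mul, add_mul, h6, h8, h3]; module
  have hSS : (b₀ + bp + bm + (α + γt) • (1 : A)) * (b₀ + bp + bm)
      = (αt + γt - α - γ) • bp + (α - αt + γ - γt) • bm := by
    rw [add_mul, mul_add, mul_add, hSp, hSm, add_mul, add_mul, h1, h5, h7, smul_mul_assoc,
      one_mul]
    module
  rw [← hs] at he₀
  generalize b₀ + bp + bm = S at *
  have e1 : e₀ + 1 = (1 - q)⁻¹ • (S + (α + γ) • (1 : A)) := by
    have : (1 : A) = ((1 - q)⁻¹ * (1 - q)) • (1 : A) := by
      rw [inv_mul_cancel₀ hq1, one_smul]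
    have h : (α + γ : F) = αt + γt + (1 - q) := by rw [hs]; ring
    rw [he₀, h, add_smul _ (1 - q), ← add_assoc, smul_add _ _ ((1 - q) • (1 : A)), smul_smul,
      ← this]
  have e2 : e₀ + (α / (α + γ)) • (1 : A) = (1 - q)⁻¹ • (S + (α + γt) • (1 : A)) := by
    have h : α / (α + γ) = (1 - q)⁻¹ * (α - αt) := by
      rw [hαt]; field_simp; ring
    rw [he₀, h]; module
  have e3 : e₀ + ((α + γ + q - 1) / (q - 1)) • (1 : A) = (1 - q)⁻¹ • S := by
    have h : (α + γ + q - 1) / (q - 1) = -((1 - q)⁻¹ * (αt + γt)) := by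
      rw [hs, ← neg_sub 1 q, div_neg, div_eq_inv_mul]
    rw [he₀, h]; module
  have key : (S + (αt + γt) • (1 : A)) * ((S + (α + γ) • (1 : A)) *
      ((S + (α + γt) • (1 : A)) * S)) = 0 := by
    have h : (S + (α + γ) • (1 : A)) * ((S + (α + γt) • (1 : A)) * S)
        = ((α - αt + γ - γt) * (α + γ - αt - γt)) • bm := by
      rw [hSS, add_mul, mul_add, mul_smul_comm, mul_smul_comm, hSp, hSm, smul_mul_assoc, one_mul]
      module
    rw [h, mul_smul_comm, add_mul, hSm, smul_mul_assoc, one_mul, neg_add_cancel, smul_zero]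
  rw [e1, e2, e3, he₀]
  simp only [smul_mul_assoc, mul_smul_comm, mul_assoc, key, smul_zero]
end
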